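/- Let X be a random vector in ℝ^d with E X = 0 and E[|X|²] = σ²d. Suppose that A := E| |X|²σ^{-2} − d | satisfies A ≤ C'√d for a constant C', and that B := sup_{ξ∈S^{d−1}} E⟨X,ξ⟩² = 1. Let Z be a standard Gaussian random vector in ℝ^k. Then there is a constant C (depending only on C') such that the average over Haar-distributed θ ∈ W_{d,k} of the conditional bounded-Lipschitz distance satisfies E d_BL(X_θ, σZ) ≤ C (k + log d)/( k^{2/3} d^{2/(3k+4)} ). -/

import Mathlib

open MeasureTheory ProbabilityTheory Real
open scoped ENNReal NNReal RealInnerProductSpace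

noncomputable section

/-- The Stiefel manifold: `k`-tuples of orthonormal vectors in `ℝ^d`. -/
def Stiefel (d k : ℕ) : Type :=
  {θ : Fin k → EuclideanSpace ℝ (Fin d) // Orthonormal ℝ θ}

instance (d k : ℕ) : MeasurableSpace (Stiefel d k) :=
  Subtype.instMeasurableSpace

/-- The metric `ρ` on the Stiefel manifold. -/
def stiefelDist {d k : ℕ} (θ θ' : Stiefel d k) : ℝ :=
  Real.sqrt (∑ j : Fin k, ‖θ.1 j - θ'.1 j‖ ^ 2)

/-- The projection `x ↦ (⟨x,θ₁⟩, …, ⟨x,θ_k⟩)` onto the span of `θ`. -/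
def stiefelProj {d k : ℕ} (θ : Stiefel d k) (x : EuclideanSpace ℝ (Fin d)) :
    EuclideanSpace ℝ (Fin k) :=
  (EuclideanSpace.equiv (Fin k) ℝ).symm fun i => ⟪θ.1 i, x⟫

/-- Rotation of a Stiefel frame by a linear isometry of `ℝ^d`. -/
def stiefelRotate {d k : ℕ}
    (U : EuclideanSpace ℝ (Fin d) ≃ₗᵢ[ℝ] EuclideanSpace ℝ (Fin d))
    (θ : Stiefel d k) : Stiefel d k :=
  ⟨fun i => U (θ.1 i), θ.2.comp_linearIsometryEquiv U⟩

/-- A probability measure on the Stiefel manifold is Haar if it is invariant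
under every rotation of `ℝ^d`. -/
def IsHaarStiefel {d k : ℕ} (μ : Measure (Stiefel d k)) : Prop :=
  IsProbabilityMeasure μ ∧
    ∀ U : EuclideanSpace ℝ (Fin d) ≃ₗᵢ[ℝ] EuclideanSpace ℝ (Fin d),
      μ.map (stiefelRotate U) = μ

/-- The standard Gaussian measure on `ℝ^k`. -/
def stdGaussian (k : ℕ) : Measure (EuclideanSpace ℝ (Fin k)) :=
  (Measure.pi fun _ : Fin k => gaussianReal 0 1).map
    (EuclideanSpace.equiv (Fin k) ℝ).symm

/-- The bounded-Lipschitz distance between two measures on `ℝ^k`: the supremum of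
`|∫ f dμ - ∫ f dν|` over `f` with `‖f‖_∞ ≤ 1` which are `1`-Lipschitz. -/
def dBL {k : ℕ} (μ ν : Measure (EuclideanSpace ℝ (Fin k))) : ℝ :=
  ⨆ f : {f : EuclideanSpace ℝ (Fin k) → ℝ // (∀ x, |f x| ≤ 1) ∧ LipschitzWith 1 f},
    |∫ x, f.1 x ∂μ - ∫ x, f.1 x ∂ν|

/-- Gaussian density of variance `s` on `ℝ^k`. -/
def gd (k : ℕ) (s : ℝ) (y : EuclideanSpace ℝ (Fin k)) : ℝ :=
  (2 * π * s) ^ (-(k : ℝ) / 2) * Real.exp (-(1 / (2 * s)) * ‖y‖ ^ 2)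

lemma gd_nonneg {k : ℕ} {s : ℝ} (hs : 0 < s) (y : EuclideanSpace ℝ (Fin k)) : 0 ≤ gd k s y := by
  unfold gd; positivity

lemma gd_le {k : ℕ} {s : ℝ} (hs : 0 < s) (y : EuclideanSpace ℝ (Fin k)) :
    gd k s y ≤ (2 * π * s) ^ (-(k : ℝ) / 2) := by
  unfold gd
  have h1 : Real.exp (-(1 / (2 * s)) * ‖y‖ ^ 2) ≤ 1 := by
    rw [Real.exp_le_one_iff]
    have : 0 ≤ (1 / (2 * s)) * ‖y‖ ^ 2 := by positivity
    linarith
  have h2 : 0 ≤ (2 * π * s) ^ (-(k : ℝ) / 2) := by positivity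
  nlinarith

lemma gd_continuous (k : ℕ) (s : ℝ) : Continuous (gd k s) := by
  unfold gd; fun_prop

lemma gd_neg {k : ℕ} {s : ℝ} (y : EuclideanSpace ℝ (Fin k)) : gd k s (-y) = gd k s y := by
  unfold gd; simp

lemma gauss_int {k : ℕ} {b : ℝ} (hb : 0 < b) :
    ∫ v : EuclideanSpace ℝ (Fin k), Real.exp (-b * ‖v‖ ^ 2) = (π / b) ^ ((k : ℝ) / 2) := by
  have := GaussianFourier.integral_rexp_neg_mul_sq_norm (V := EuclideanSpace ℝ (Fin k)) hb
  simpa using this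

lemma gauss_integrable {k : ℕ} {b : ℝ} (hb : 0 < b) :
    Integrable (fun v : EuclideanSpace ℝ (Fin k) => Real.exp (-b * ‖v‖ ^ 2)) := by
  by_contra h
  have h1 := gauss_int (k := k) hb
  rw [integral_undef h] at h1
  have : 0 < (π / b) ^ ((k : ℝ) / 2) := by positivity
  linarith

lemma gd_integrable {k : ℕ} {s : ℝ} (hs : 0 < s) : Integrable (gd k s) := by
  unfold gd
  exact (gauss_integrable (by positivity)).const_mul _

lemma gd_integral {k : ℕ} {s : ℝ} (hs : 0 < s) : ∫ y, gd k s y = 1 := by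
  unfold gd
  rw [integral_const_mul, gauss_int (by positivity)]
  have : π / (1 / (2 * s)) = 2 * π * s := by field_simp
  rw [this, ← Real.rpow_add (by positivity)]
  have : -(k : ℝ) / 2 + k / 2 = 0 := by ring
  rw [this, Real.rpow_zero]

lemma gd_conv {k : ℕ} {s t : ℝ} (hs : 0 < s) (ht : 0 < t) (a b : EuclideanSpace ℝ (Fin k)) :
    ∫ y, gd k s (y - a) * gd k t (y - b) = gd k (s + t) (a - b) := by
  have key : ∀ y, gd k s (y - a) * gd k t (y - b) =
      ((2 * π * s) ^ (-(k : ℝ) / 2) * (2 * π * t) ^ (-(k : ℝ) / 2) *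
        Real.exp (-(1 / (2 * (s + t))) * ‖a - b‖ ^ 2)) *
        Real.exp (-((s + t) / (2 * s * t)) * ‖y - ((t / (s + t)) • a + (s / (s + t)) • b)‖ ^ 2) := by
    intro y
    unfold gd
    have : ∀ A B C D : ℝ, A * Real.exp B * (C * Real.exp D) = A * C * Real.exp (B + D) := by
      intro A B C D; rw [Real.exp_add]; ring
    rw [this, mul_assoc _ (Real.exp _) (Real.exp _), ← Real.exp_add]
    congr 2
    simp only [← real_inner_self_eq_norm_sq]
    simp only [inner_sub_left, inner_sub_right, inner_add_left, inner_add_right,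
      real_inner_smul_left, real_inner_smul_right]
    rw [real_inner_comm y a, real_inner_comm y b, real_inner_comm a b]
    have hst : s + t ≠ 0 := by positivity
    field_simp
    ring
  simp_rw [key]
  rw [integral_const_mul, integral_sub_right_eq_self
    (fun y : EuclideanSpace ℝ (Fin k) => Real.exp (-((s + t) / (2 * s * t)) * ‖y‖ ^ 2)),
    gauss_int (by positivity)]
  unfold gd
  have h1 : (2 * π * (s + t)) ^ (-(k : ℝ) / 2) =
     (2 * π * s) ^ (-(k : ℝ) / 2) * (2 * π * t) ^ (-(k : ℝ) / 2) *
     (π / ((s + t) / (2 * s * t))) ^ ((k : ℝ) / 2) := by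
    have e : (π / ((s + t) / (2 * s * t))) ^ ((k : ℝ) / 2) =
       ((s + t) / (2 * s * t) / π) ^ (-(k : ℝ) / 2) := by
      rw [neg_div, Real.rpow_neg (by positivity), ← Real.inv_rpow (by positivity), inv_div]
    rw [e, ← Real.mul_rpow (by positivity) (by positivity),
      ← Real.mul_rpow (by positivity) (by positivity)]
    congr 1
    have : π ≠ 0 := by positivity
    field_simp
  rw [h1]; ring

lemma gd_conv' {k : ℕ} {s t : ℝ} (hs : 0 < s) (ht : 0 < t) (a : EuclideanSpace ℝ (Fin k)) :
    ∫ y, gd k s (y - a) * gd k t y = gd k (s + t) a := by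
  have := gd_conv (k := k) hs ht a 0
  simpa using this

/-- value at the origin -/
lemma gd_scaled_int {k : ℕ} {s : ℝ} (hs : 0 < s) (c : ℝ) :
    ∫ z, gd k s (c • z) * gd k 1 z = (2 * π * (s + c ^ 2)) ^ (-(k : ℝ) / 2) := by
  have key : ∀ z, gd k s (c • z) * gd k 1 z =
      ((2 * π * s) ^ (-(k : ℝ) / 2) * (2 * π * 1) ^ (-(k : ℝ) / 2)) *
        Real.exp (-((s + c ^ 2) / (2 * s)) * ‖z‖ ^ 2) := by
    intro z
    unfold gd
    have : ∀ A B C D : ℝ, A * Real.exp B * (C * Real.exp D) = A * C * Real.exp (B + D) := by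
      intro A B C D; rw [Real.exp_add]; ring
    rw [this]
    congr 2
    rw [norm_smul, mul_pow, Real.norm_eq_abs, sq_abs]
    field_simp
    ring
  simp_rw [key]
  rw [integral_const_mul, gauss_int (by positivity)]
  have e : (π / ((s + c ^ 2) / (2 * s))) ^ ((k : ℝ) / 2) =
       ((s + c ^ 2) / (2 * s) / π) ^ (-(k : ℝ) / 2) := by
    rw [neg_div, Real.rpow_neg (by positivity), ← Real.inv_rpow (by positivity), inv_div]
  rw [e, ← Real.mul_rpow (by positivity) (by positivity),
      ← Real.mul_rpow (by positivity) (by positivity)]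
  congr 1
  have : π ≠ 0 := by positivity
  field_simp

lemma stdG_eq (k : ℕ) : _root_.stdGaussian k =
    ProbabilityTheory.stdGaussian (EuclideanSpace ℝ (Fin k)) := by
  rw [← map_pi_eq_stdGaussian]; rfl

instance (k : ℕ) : IsProbabilityMeasure (_root_.stdGaussian k) := by
  rw [stdG_eq]; infer_instance

lemma stdG_density (k : ℕ) : _root_.stdGaussian k =
    volume.withDensity (fun y => ENNReal.ofReal (gd k 1 y)) := by
  have hfin : IsFiniteMeasure
      (volume.withDensity (fun y => ENNReal.ofReal (gd k 1 y))) :=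
    isFiniteMeasure_withDensity_ofReal (gd_integrable one_pos).2
  rw [stdG_eq]
  apply Measure.ext_of_charFun
  ext t
  rw [charFun_stdGaussian, charFun_apply, integral_withDensity_eq_integral_toReal_smul
    (by have := gd_continuous k 1; fun_prop) (by simp)]
  have hb : 0 < ((1 / 2 : ℝ) : ℂ).re := by norm_num
  have := GaussianFourier.integral_cexp_neg_mul_sq_norm_add hb Complex.I t
  have h2 : ∀ x : EuclideanSpace ℝ (Fin k), (ENNReal.ofReal (gd k 1 x)).toReal •
      Complex.exp (⟪x, t⟫ * Complex.I) =
      (((2 * π * 1) ^ (-(k : ℝ) / 2) : ℝ) : ℂ) *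
      Complex.exp (-((1 / 2 : ℝ) : ℂ) * ‖x‖ ^ 2 + Complex.I * ⟪t, x⟫) := by
    intro x
    rw [ENNReal.toReal_ofReal (gd_nonneg one_pos x)]
    unfold gd
    rw [Complex.real_smul, Complex.exp_add]
    push_cast
    rw [real_inner_comm]
    ring_nf
  simp_rw [h2]
  rw [integral_const_mul, this]
  have h3 : ((π : ℂ) / ((1 / 2 : ℝ) : ℂ)) ^ ((Module.finrank ℝ (EuclideanSpace ℝ (Fin k)) : ℂ) / 2)
     = (((2 * π * 1) ^ ((k : ℝ) / 2) : ℝ) : ℂ) := by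
    rw [Complex.ofReal_cpow (by positivity)]
    congr 1
    · push_cast; ring
    · simp
  rw [h3, ← mul_assoc, ← Complex.ofReal_mul, ← Real.rpow_add (by positivity)]
  have : -(k : ℝ) / 2 + k / 2 = 0 := by ring
  rw [this, Real.rpow_zero]
  simp only [Complex.ofReal_one, one_mul, Complex.I_sq]
  congr 1
  push_cast
  ring

lemma stdG_integral {k : ℕ} (F : EuclideanSpace ℝ (Fin k) → ℝ) :
    ∫ z, F z ∂(_root_.stdGaussian k) = ∫ z, F z * gd k 1 z := by
  rw [stdG_density, integral_withDensity_eq_integral_toReal_smul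
    (by have := gd_continuous k 1; fun_prop) (by simp)]
  congr 1; ext z
  rw [ENNReal.toReal_ofReal (gd_nonneg one_pos z), smul_eq_mul, mul_comm]

lemma gd_scale_integral {k : ℕ} {s : ℝ} (hs : 0 < s) (F : EuclideanSpace ℝ (Fin k) → ℝ) :
    ∫ y, F y * gd k s y = ∫ z, F (√s • z) ∂(_root_.stdGaussian k) := by
  rw [stdG_integral]
  have h := Measure.integral_comp_smul (volume : Measure (EuclideanSpace ℝ (Fin k)))
    (fun y => F y * gd k s y) (√s)
  have h0 : 0 < √s := Real.sqrt_pos.2 hs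
  have h1 : ∀ z, F (√s • z) * gd k 1 z = (√s ^ k) * (F (√s • z) * gd k s (√s • z)) := by
    intro z
    unfold gd
    have e1 : -(1 / (2 * s)) * ‖√s • z‖ ^ 2 = -(1 / (2 * 1)) * ‖z‖ ^ 2 := by
      rw [norm_smul, mul_pow, Real.norm_eq_abs, sq_abs, Real.sq_sqrt hs.le]
      field_simp
    have e2 : √s ^ k * (2 * π * s) ^ (-(k : ℝ) / 2) = (2 * π * 1) ^ (-(k : ℝ) / 2) := by
      rw [← Real.rpow_natCast, Real.sqrt_eq_rpow, ← Real.rpow_mul hs.le,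
        Real.mul_rpow (by positivity) hs.le, mul_comm, mul_assoc, ← Real.rpow_add hs]
      have : -(k : ℝ) / 2 + 1 / 2 * k = 0 := by ring
      rw [this, mul_one]; simp
    rw [e1, ← e2]; ring
  simp_rw [h1]
  rw [integral_const_mul, h]
  simp only [finrank_euclideanSpace, Fintype.card_fin, smul_eq_mul]
  rw [abs_of_pos (by positivity), ← mul_assoc, mul_inv_cancel₀ (by positivity), one_mul]

lemma stdG_memLp (k : ℕ) (p : ℝ≥0∞) (hp : p ≠ ∞) : MemLp id p (_root_.stdGaussian k) := by
  rw [stdG_eq]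
  exact IsGaussian.memLp_id _ p hp

lemma stdG_sq (k : ℕ) : ∫ z, ‖z‖ ^ 2 ∂(_root_.stdGaussian k) = k := by
  have hi : ∀ i : Fin k, Integrable (fun z : EuclideanSpace ℝ (Fin k) => (z i) ^ 2)
      (_root_.stdGaussian k) := by
    intro i
    have := (EuclideanSpace.proj (𝕜 := ℝ) i).comp_memLp' (stdG_memLp k 2 (by simp))
    exact this.integrable_sq
  simp_rw [EuclideanSpace.real_norm_sq_eq]
  rw [integral_finsetSum _ (fun i _ => hi i)]
  have : ∀ i : Fin k, ∫ z : EuclideanSpace ℝ (Fin k), (z i) ^ 2 ∂(_root_.stdGaussian k) = 1 := by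
    intro i
    have h := variance_dual_stdGaussian (E := EuclideanSpace ℝ (Fin k))
      (EuclideanSpace.proj (𝕜 := ℝ) i)
    rw [variance_of_integral_eq_zero (by fun_prop) (integral_strongDual_stdGaussian _)] at h
    have hn : ‖(EuclideanSpace.proj i : EuclideanSpace ℝ (Fin k) →L[ℝ] ℝ)‖ = 1 := by
      have : (EuclideanSpace.proj i : EuclideanSpace ℝ (Fin k) →L[ℝ] ℝ) =
          innerSL ℝ (EuclideanSpace.single i (1 : ℝ)) := by
        ext z; simp [EuclideanSpace.inner_single_left]
      rw [this, innerSL_apply_norm]; simp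
    rw [hn] at h
    rw [stdG_eq]
    simpa using h
  simp [this]

lemma stdG_norm_int (k : ℕ) : Integrable (fun z => ‖z‖) (_root_.stdGaussian k) :=
  ((stdG_memLp k 1 (by simp)).integrable le_rfl).norm

/-- `(E|X|)² ≤ E X²`. -/
lemma sq_int_le {α : Type*} [MeasurableSpace α] {m : Measure α} [IsProbabilityMeasure m]
    {F : α → ℝ} (hF : MemLp F 2 m) : (∫ x, F x ∂m) ^ 2 ≤ ∫ x, F x ^ 2 ∂m := by
  have h := variance_nonneg F m
  rw [variance_eq_sub hF] at h
  simp only [Pi.pow_apply] at h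
  linarith

lemma stdG_norm_le (k : ℕ) : ∫ z, ‖z‖ ∂(_root_.stdGaussian k) ≤ √k := by
  apply Real.le_sqrt_of_sq_le
  rw [← stdG_sq k]
  exact sq_int_le (stdG_memLp k 2 (by simp)).norm

lemma stdG_tail {k : ℕ} {L ρ : ℝ} (h : 4 * (k + L) ≤ ρ ^ 2) (hρ : 0 ≤ ρ) :
    (_root_.stdGaussian k).real {z | ρ < ‖z‖} ≤ Real.exp (-L) := by
  have e : ∀ z, Real.exp ((1 / 4) * ‖z‖ ^ 2) * gd k 1 z =
      (2 * π * 1) ^ (-(k : ℝ) / 2) * Real.exp (-(1 / 4) * ‖z‖ ^ 2) := by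
    intro z
    unfold gd
    rw [mul_left_comm, ← Real.exp_add]; congr 2; ring
  have hIntg : Integrable (fun z => Real.exp ((1 / 4) * ‖z‖ ^ 2)) (_root_.stdGaussian k) := by
    rw [stdG_density, integrable_withDensity_iff_integrable_smul'
      (by have := gd_continuous k 1; fun_prop) (by simp)]
    have : ∀ z, (ENNReal.ofReal (gd k 1 z)).toReal • Real.exp ((1 / 4) * ‖z‖ ^ 2) =
       (2 * π * 1) ^ (-(k : ℝ) / 2) * Real.exp (-(1 / 4) * ‖z‖ ^ 2) := by
      intro z
      rw [ENNReal.toReal_ofReal (gd_nonneg one_pos z), smul_eq_mul, mul_comm, e]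
    simp_rw [this]
    exact (gauss_integrable (by norm_num)).const_mul _
  have hval : ∫ z, Real.exp ((1 / 4) * ‖z‖ ^ 2) ∂(_root_.stdGaussian k) = 2 ^ ((k : ℝ) / 2) := by
    rw [stdG_integral]
    simp_rw [e]
    rw [integral_const_mul, gauss_int (by norm_num), neg_div, Real.rpow_neg (by positivity),
      inv_mul_eq_div, ← Real.div_rpow (by positivity) (by positivity)]
    congr 1
    have : π ≠ 0 := by positivity
    field_simp; norm_num
  have hm := mul_meas_ge_le_integral_of_nonneg (μ := _root_.stdGaussian k)
    (Filter.Eventually.of_forall fun z => (Real.exp_pos ((1 / 4) * ‖z‖ ^ 2)).le) hIntg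
    (Real.exp (k + L))
  rw [hval] at hm
  have hsub : (_root_.stdGaussian k).real {z | ρ < ‖z‖} ≤
      (_root_.stdGaussian k).real {z | Real.exp (k + L) ≤ Real.exp ((1 / 4) * ‖z‖ ^ 2)} := by
    apply measureReal_mono _ (by finiteness)
    intro z hz
    simp only [Set.mem_ofPred_eq] at hz ⊢
    rw [Real.exp_le_exp]
    nlinarith
  have h2 : (2 : ℝ) ^ ((k : ℝ) / 2) ≤ Real.exp k := by
    rw [← Real.exp_one_rpow]
    calc (2 : ℝ) ^ ((k : ℝ) / 2) ≤ Real.exp 1 ^ ((k : ℝ) / 2) := by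
          apply Real.rpow_le_rpow (by norm_num) (by linarith [Real.add_one_le_exp (1 : ℝ)])
            (by positivity)
      _ ≤ _ := by
          apply Real.rpow_le_rpow_of_exponent_le (by linarith [Real.add_one_le_exp (1 : ℝ)])
          have : (0 : ℝ) ≤ k := by positivity
          linarith
  refine hsub.trans ?_
  have h3 : Real.exp k * (Real.exp L * (_root_.stdGaussian k).real
     {z | Real.exp (k + L) ≤ Real.exp ((1 / 4) * ‖z‖ ^ 2)}) ≤ Real.exp k := by
    rw [← mul_assoc, ← Real.exp_add]; linarith
  have h4 := le_of_mul_le_mul_left (h3.trans_eq (mul_one _).symm) (Real.exp_pos _)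
  rw [Real.exp_neg, ← one_div, le_div_iff₀ (Real.exp_pos _), mul_comm]
  exact h4

lemma ball_vol {k : ℕ} (hk : 0 < k) {R : ℝ} (hR : 0 < R) :
    (volume : Measure (EuclideanSpace ℝ (Fin k))).real (Metric.closedBall 0 R) ≤
      (2 * π * Real.exp 1 * R ^ 2 / k) ^ ((k : ℝ) / 2) := by
  have hk' : (0 : ℝ) < k := by exact_mod_cast hk
  set b : ℝ := k / (2 * R ^ 2) with hb
  have hbp : 0 < b := by positivity
  have hm := mul_meas_ge_le_integral_of_nonneg (μ := (volume : Measure (EuclideanSpace ℝ (Fin k))))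
    (Filter.Eventually.of_forall fun z => (Real.exp_pos (-b * ‖z‖ ^ 2)).le) (gauss_integrable hbp)
    (Real.exp (-(k / 2)))
  rw [gauss_int hbp] at hm
  have hset : {z : EuclideanSpace ℝ (Fin k) | Real.exp (-(k / 2)) ≤ Real.exp (-b * ‖z‖ ^ 2)} =
      Metric.closedBall 0 R := by
    ext z
    simp only [Set.mem_ofPred_eq, Metric.mem_closedBall, dist_zero_right, Real.exp_le_exp]
    rw [← sq_le_sq₀ (norm_nonneg _) hR.le, neg_mul, neg_le_neg_iff, hb]
    have : (k : ℝ) / (2 * R ^ 2) * ‖z‖ ^ 2 = (k / 2) * (‖z‖ ^ 2 / R ^ 2) := by field_simp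
    rw [this]
    have hk2 : (0 : ℝ) < k / 2 := by positivity
    rw [mul_le_iff_le_one_right hk2, div_le_one (by positivity)]
  rw [hset] at hm
  have h2 : (2 * π * Real.exp 1 * R ^ 2 / k) ^ ((k : ℝ) / 2) =
      Real.exp (k / 2) * (π / b) ^ ((k : ℝ) / 2) := by
    rw [← Real.exp_one_rpow (k / 2 : ℝ), ← Real.mul_rpow (by positivity) (by positivity)]
    congr 1
    rw [hb]; field_simp
  rw [h2, ← div_le_iff₀' (Real.exp_pos _), div_eq_inv_mul, ← Real.exp_neg]
  exact hm

lemma stiefelProj_apply {d k : ℕ} (θ : Stiefel d k) (x : EuclideanSpace ℝ (Fin d)) (i : Fin k) :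
    stiefelProj θ x i = ⟪θ.1 i, x⟫ := rfl

lemma measurable_stiefelProj (d k : ℕ) :
    Measurable (fun q : Stiefel d k × EuclideanSpace ℝ (Fin d) => stiefelProj q.1 q.2) := by
  have h : Measurable (fun q : Stiefel d k × EuclideanSpace ℝ (Fin d) =>
      (fun i => ⟪q.1.1 i, q.2⟫ : Fin k → ℝ)) := by
    apply measurable_pi_lambda
    intro i
    have h1 : Measurable (fun q : Stiefel d k × EuclideanSpace ℝ (Fin d) => q.1.1 i) :=
      (measurable_pi_apply i).comp (measurable_subtype_coe.comp measurable_fst)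
    exact h1.inner measurable_snd
  exact (EuclideanSpace.equiv (Fin k) ℝ).symm.continuous.measurable.comp h

lemma measurable_stiefelProj_left {d k : ℕ} (y : EuclideanSpace ℝ (Fin d)) :
    Measurable (fun θ : Stiefel d k => stiefelProj θ y) :=
  (measurable_stiefelProj d k).comp (measurable_id.prodMk measurable_const)

lemma measurable_stiefelRotate {d k : ℕ}
    (U : EuclideanSpace ℝ (Fin d) ≃ₗᵢ[ℝ] EuclideanSpace ℝ (Fin d)) :
    Measurable (stiefelRotate (k := k) U) := by
  apply Measurable.subtype_mk
  apply measurable_pi_lambda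
  intro i
  exact U.continuous.measurable.comp ((measurable_pi_apply i).comp measurable_subtype_coe)

lemma stiefelProj_smul {d k : ℕ} (θ : Stiefel d k) (c : ℝ) (x : EuclideanSpace ℝ (Fin d)) :
    stiefelProj θ (c • x) = c • stiefelProj θ x := by
  ext i; simp [stiefelProj_apply, real_inner_smul_right]

lemma stiefelProj_sub {d k : ℕ} (θ : Stiefel d k) (x y : EuclideanSpace ℝ (Fin d)) :
    stiefelProj θ (x - y) = stiefelProj θ x - stiefelProj θ y := by
  ext i; simp [stiefelProj_apply, inner_sub_right]

lemma stiefelProj_rotate {d k : ℕ} (θ : Stiefel d k)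
    (U : EuclideanSpace ℝ (Fin d) ≃ₗᵢ[ℝ] EuclideanSpace ℝ (Fin d)) (x : EuclideanSpace ℝ (Fin d)) :
    stiefelProj (stiefelRotate U θ) (U x) = stiefelProj θ x := by
  ext i
  rw [stiefelProj_apply, stiefelProj_apply]
  exact U.inner_map_map _ _

lemma stdG_map_proj {d k : ℕ} (θ : Stiefel d k) :
    (_root_.stdGaussian d).map (stiefelProj θ) = _root_.stdGaussian k := by
  have hm : Measurable (stiefelProj θ) :=
    (measurable_stiefelProj d k).comp measurable_prodMk_left
  have : IsProbabilityMeasure ((_root_.stdGaussian d).map (stiefelProj θ)) :=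
    Measure.isProbabilityMeasure_map hm.aemeasurable
  apply Measure.ext_of_charFun
  ext t
  have hin : ∀ x, ⟪stiefelProj θ x, t⟫ = ⟪x, ∑ i, t i • θ.1 i⟫ := by
    intro x
    rw [inner_sum, PiLp.inner_apply]
    refine Finset.sum_congr rfl fun i _ => ?_
    rw [real_inner_smul_right, stiefelProj_apply, real_inner_comm x]
    simp
  have hn : ‖∑ i, t i • θ.1 i‖ ^ 2 = ‖t‖ ^ 2 := by
    rw [← real_inner_self_eq_norm_sq, θ.2.inner_sum, EuclideanSpace.real_norm_sq_eq]
    refine Finset.sum_congr rfl fun i _ => ?_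
    simp [sq]
  rw [charFun_apply, integral_map hm.aemeasurable (by fun_prop)]
  simp_rw [hin]
  rw [← charFun_apply, stdG_eq, stdG_eq, charFun_stdGaussian, charFun_stdGaussian]
  norm_cast
  rw [hn]

/-- The randomly scaled Haar projection has exactly Gaussian one-point marginals. -/
lemma proj_law {d k : ℕ} {μ : Measure (Stiefel d k)} (hμ : IsHaarStiefel μ)
    (y : EuclideanSpace ℝ (Fin d)) :
    (μ.prod (_root_.stdGaussian d)).map (fun ξ => (‖ξ.2‖ / √d) • stiefelProj ξ.1 y) =
      (_root_.stdGaussian k).map (fun z => (‖y‖ / √d) • z) := by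
  have := hμ.1
  have hm1 : Measurable (fun ξ : Stiefel d k × EuclideanSpace ℝ (Fin d) =>
      (‖ξ.2‖ / √d) • stiefelProj ξ.1 y) := by
    have h := (measurable_stiefelProj d k).comp
      (measurable_fst.prodMk (measurable_const (a := y)) :
        Measurable (fun ξ : Stiefel d k × EuclideanSpace ℝ (Fin d) => (ξ.1, y)))
    exact (measurable_snd.norm.div_const _).smul h
  have hm2 : Measurable (fun ξ : Stiefel d k × EuclideanSpace ℝ (Fin d) =>
      (‖y‖ / √d) • stiefelProj ξ.1 ξ.2) :=
    Measurable.const_smul (measurable_stiefelProj d k) (‖y‖ / √d)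
  apply Measure.ext_of_lintegral
  intro F hF
  rw [lintegral_map hF hm1, lintegral_map hF (by fun_prop)]
  have hsw := lintegral_prod_symm' (μ := μ) (ν := _root_.stdGaussian d) _ (hF.comp hm1)
  simp only [Function.comp_apply] at hsw
  rw [hsw]
  have hstep : ∀ g : EuclideanSpace ℝ (Fin d),
      ∫⁻ θ, F ((‖g‖ / √d) • stiefelProj θ y) ∂μ =
        ∫⁻ θ, F ((‖y‖ / √d) • stiefelProj θ g) ∂μ := by
    intro g
    have hnorm : ‖‖g‖ • y‖ = ‖‖y‖ • g‖ := by simp [norm_smul, mul_comm]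
    set U : EuclideanSpace ℝ (Fin d) ≃ₗᵢ[ℝ] EuclideanSpace ℝ (Fin d) :=
      (ℝ ∙ (‖g‖ • y - ‖y‖ • g))ᗮ.reflection
    have hU : U (‖g‖ • y) = ‖y‖ • g := Submodule.reflection_sub hnorm
    have hp : ∀ θ : Stiefel d k, (‖g‖ / √d) • stiefelProj θ y =
        (‖y‖ / √d) • stiefelProj (stiefelRotate U θ) g := by
      intro θ
      have : ‖g‖ • stiefelProj θ y = ‖y‖ • stiefelProj (stiefelRotate U θ) g := by
        rw [← stiefelProj_smul, ← stiefelProj_smul, ← hU, stiefelProj_rotate]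
      rw [div_eq_inv_mul, div_eq_inv_mul, mul_smul, mul_smul, this]
    simp_rw [hp]
    have hmg : Measurable (fun θ : Stiefel d k => F ((‖y‖ / √d) • stiefelProj θ g)) :=
      hF.comp (Measurable.const_smul (measurable_stiefelProj_left g) (‖y‖ / √d))
    rw [← lintegral_map hmg (measurable_stiefelRotate U), hμ.2 U]
  simp_rw [hstep]
  have hmm : Measurable (fun ξ : Stiefel d k × EuclideanSpace ℝ (Fin d) =>
      F ((‖y‖ / √d) • stiefelProj ξ.1 ξ.2)) := hF.comp hm2
  have hsw1 := lintegral_prod_symm' (μ := μ) (ν := _root_.stdGaussian d) _ hmm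
  rw [← hsw1, lintegral_prod _ hmm.aemeasurable]
  have hin : ∀ θ : Stiefel d k, ∫⁻ g, F ((‖y‖ / √d) • stiefelProj θ g) ∂(_root_.stdGaussian d) =
      ∫⁻ z, F ((‖y‖ / √d) • z) ∂(_root_.stdGaussian k) := by
    intro θ
    have hm : Measurable (stiefelProj θ) :=
      (measurable_stiefelProj d k).comp measurable_prodMk_left
    rw [← stdG_map_proj θ, lintegral_map (by fun_prop) hm]
  simp_rw [hin]
  simp

/-- concentration of the norm of a Gaussian vector -/
lemma norm_conc : ∃ v : ℝ, 0 < v ∧ ∀ d : ℕ, 0 < d →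
    Integrable (fun g : EuclideanSpace ℝ (Fin d) => |‖g‖ / √d - 1|) (_root_.stdGaussian d) ∧
    ∫ g, |‖g‖ / √d - 1| ∂(_root_.stdGaussian d) ≤ v / √d := by
  set w : ℝ := Var[fun x : ℝ => x ^ 2; gaussianReal 0 1] with hw
  have hw0 : 0 ≤ w := variance_nonneg _ _
  refine ⟨√w + 1, by positivity, fun d hd => ?_⟩
  have hd' : (0 : ℝ) < d := by exact_mod_cast hd
  have hL2 : MemLp (fun x : ℝ => x ^ 2) 2 (gaussianReal 0 1) := by
    have h4 : MemLp (fun x : ℝ => x) 4 (gaussianReal 0 1) :=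
      memLp_id_gaussianReal' 4 (by simp)
    have h := MemLp.mul (p := 4) (q := 4) (r := 2) h4 h4
      (hpqr := ⟨by
        have e : (4 : ℝ≥0∞) = 2 * 2 := by norm_num
        rw [e, ENNReal.mul_inv (by simp) (by simp), ← mul_add, ENNReal.inv_two_add_inv_two, mul_one]⟩)
    convert h using 1
    ext x; simp [sq]
  have hpi := variance_sum_pi (μ := fun _ : Fin d => gaussianReal 0 1)
    (X := fun _ : Fin d => fun x : ℝ => x ^ 2) (fun _ => hL2)
  have hmem : MemLp (fun g : EuclideanSpace ℝ (Fin d) => ‖g‖ ^ 2) 2 (_root_.stdGaussian d) := by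
    have h4 : MemLp (fun g : EuclideanSpace ℝ (Fin d) => ‖g‖) 4 (_root_.stdGaussian d) :=
      (stdG_memLp d 4 (by simp)).norm
    have h := MemLp.mul (p := 4) (q := 4) (r := 2) h4 h4
      (hpqr := ⟨by
        have e : (4 : ℝ≥0∞) = 2 * 2 := by norm_num
        rw [e, ENNReal.mul_inv (by simp) (by simp), ← mul_add, ENNReal.inv_two_add_inv_two, mul_one]⟩)
    convert h using 1
    ext x; simp [sq]
  have hvar : Var[fun g : EuclideanSpace ℝ (Fin d) => ‖g‖ ^ 2; _root_.stdGaussian d] = d * w := by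
    unfold _root_.stdGaussian
    rw [variance_map (by fun_prop) (by fun_prop)]
    have : ((fun g : EuclideanSpace ℝ (Fin d) => ‖g‖ ^ 2) ∘ (EuclideanSpace.equiv (Fin d) ℝ).symm) =
      ∑ i : Fin d, fun x : Fin d → ℝ => (x i) ^ 2 := by
      ext x
      simp [EuclideanSpace.real_norm_sq_eq]
    rw [this, hpi]
    simp [hw]
  rw [variance_eq_integral (by fun_prop), stdG_sq] at hvar
  have hmem2 : MemLp (fun g : EuclideanSpace ℝ (Fin d) => |‖g‖ ^ 2 - d|) 2 (_root_.stdGaussian d) :=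
    (hmem.sub (memLp_const _)).norm
  have hs := sq_int_le hmem2
  simp only [sq_abs] at hs
  rw [hvar] at hs
  have hs' : ∫ g, |‖g‖ ^ 2 - d| ∂(_root_.stdGaussian d) ≤ √d * √w := by
    rw [← Real.sqrt_mul (by positivity)]
    exact Real.le_sqrt_of_sq_le hs
  have hpt : ∀ g : EuclideanSpace ℝ (Fin d), |‖g‖ / √d - 1| ≤ |‖g‖ ^ 2 - d| / d := by
    intro g
    have hsd : 0 < √(d : ℝ) := Real.sqrt_pos.2 hd'
    have e : (‖g‖ ^ 2 - d) / d = (‖g‖ / √d - 1) * (‖g‖ / √d + 1) := by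
      have : (‖g‖ / √d) ^ 2 = ‖g‖ ^ 2 / d := by rw [div_pow, Real.sq_sqrt hd'.le]
      have h2 : (‖g‖ / √d - 1) * (‖g‖ / √d + 1) = (‖g‖ / √d) ^ 2 - 1 := by ring
      rw [h2, this]; field_simp
    have e2 : |‖g‖ ^ 2 - d| / d = |(‖g‖ ^ 2 - d) / d| := by rw [abs_div, abs_of_pos hd']
    rw [e2, e, abs_mul]
    have h3 : 1 ≤ |‖g‖ / √d + 1| := by
      have : 0 ≤ ‖g‖ / √d := by positivity
      rw [abs_of_pos (by linarith)]; linarith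
    nlinarith [abs_nonneg (‖g‖ / √d - 1)]
  have hIntg : Integrable (fun g : EuclideanSpace ℝ (Fin d) => |‖g‖ ^ 2 - d| / d)
      (_root_.stdGaussian d) := (hmem2.integrable (by norm_num)).div_const _
  have hIntg1 : Integrable (fun g : EuclideanSpace ℝ (Fin d) => |‖g‖ / √d - 1|)
      (_root_.stdGaussian d) := by
    refine hIntg.mono' (by fun_prop) (Filter.Eventually.of_forall fun g => ?_)
    rw [Real.norm_eq_abs, abs_abs]; exact hpt g
  refine ⟨hIntg1, ?_⟩
  calc _ ≤ ∫ g, |‖g‖ ^ 2 - d| / d ∂(_root_.stdGaussian d) := integral_mono hIntg1 hIntg hpt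
    _ ≤ (√d * √w) / d := by rw [integral_div]; gcongr
    _ = √w / √d := by
        have : (d : ℝ) = √d * √d := (Real.mul_self_sqrt hd'.le).symm
        have hsd : 0 < √(d : ℝ) := Real.sqrt_pos.2 hd'
        rw [div_eq_div_iff hd'.ne' hsd.ne']
        nth_rewrite 3 [this]; ring
    _ ≤ _ := by gcongr; linarith

lemma mixed_diff {u u' : ℝ → ℝ} {K : ℝ}
    (hu : ∀ x, 1 / 4 ≤ x → HasDerivAt u (u' x) x)
    (hL : ∀ x y, 1 / 4 ≤ x → 1 / 4 ≤ y → |u' x - u' y| ≤ K * |x - y|)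
    {a b : ℝ} (ha : -1 ≤ a) (hb : -1 ≤ b) (hab : 1 / 2 ≤ 2 + a + b) :
    |u (2 + a + b) - u (2 + a) - u (2 + b) + u 2| ≤ K * (|a| * |b|) := by
  have hx : ∀ x ∈ Set.uIcc 2 (2 + a), 1 / 4 ≤ x ∧ 1 / 4 ≤ x + b := by
    intro x hx
    rw [Set.mem_uIcc] at hx
    rcases hx with h | h <;> constructor <;> linarith
  have h := Convex.norm_image_sub_le_of_norm_hasDerivWithin_le (𝕜 := ℝ)
    (f := fun x => u (x + b) - u x) (f' := fun x => u' (x + b) - u' x) (C := K * |b|)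
    (s := Set.uIcc 2 (2 + a)) (x := 2) (y := 2 + a)
    (fun x hxx => by
      obtain ⟨h1, h2⟩ := hx x hxx
      have e1 : HasDerivAt (fun x => u (x + b)) (u' (x + b)) x := (hu _ h2).comp_add_const x b
      exact (e1.sub (hu _ h1)).hasDerivWithinAt)
    (fun x hxx => by
      obtain ⟨h1, h2⟩ := hx x hxx
      have := hL _ _ h2 h1
      rw [Real.norm_eq_abs]
      simpa using this)
    (convex_uIcc _ _) Set.left_mem_uIcc Set.right_mem_uIcc
  simp only [Real.norm_eq_abs] at h
  have e : u (2 + a + b) - u (2 + a) - u (2 + b) + u 2 =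
    u (2 + a + b) - u (2 + a) - (u (2 + b) - u 2) := by ring
  rw [e]
  refine h.trans (le_of_eq ?_)
  rw [add_sub_cancel_left]; ring

lemma lip_of_deriv {u u' : ℝ → ℝ} {K : ℝ}
    (hu : ∀ x, 1 / 4 ≤ x → HasDerivAt u (u' x) x) (hb : ∀ x, 1 / 4 ≤ x → |u' x| ≤ K) :
    ∀ x y, 1 / 4 ≤ x → 1 / 4 ≤ y → |u x - u y| ≤ K * |x - y| := by
  intro x y hx hy
  have h := Convex.norm_image_sub_le_of_norm_hasDerivWithin_le (𝕜 := ℝ)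
    (f := u) (f' := u') (C := K) (s := Set.Ici (1 / 4)) (x := y) (y := x)
    (fun x hxx => (hu x hxx).hasDerivWithinAt) (fun x hxx => hb x hxx)
    (convex_Ici _) hy hx
  simpa [Real.norm_eq_abs] using h

/-- value at the origin of the Gaussian density of variance `2 τ + s` -/
def Hf (p τ s : ℝ) : ℝ := (2 * π * (2 * τ + s)) ^ p

lemma Hf_deriv {p τ : ℝ} (hτ : 0 < τ) {x : ℝ} (hx : 0 ≤ x) :
    HasDerivAt (Hf p τ) (2 * π * p * Hf (p - 1) τ x) x := by
  unfold Hf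
  have h1 : HasDerivAt (fun s : ℝ => 2 * π * (2 * τ + s)) (2 * π * 1) x :=
    ((hasDerivAt_id x).const_add (2 * τ)).const_mul _
  have hne : 2 * π * (2 * τ + x) ≠ 0 := by positivity
  have := h1.rpow_const (p := p) (Or.inl hne)
  convert this using 1
  ring

lemma Hf_nonneg {p τ : ℝ} (hτ : 0 < τ) {x : ℝ} (hx : 0 ≤ x) : 0 ≤ Hf p τ x := by
  unfold Hf; positivity

lemma Hf_le_one {p τ : ℝ} (hτ : 0 < τ) (hp : p ≤ 0) {x : ℝ} (hx : 1 / 4 ≤ x) :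
    Hf p τ x ≤ 1 := by
  unfold Hf
  apply Real.rpow_le_one_of_one_le_of_nonpos _ hp
  nlinarith [Real.pi_gt_three]

lemma Hf_le {p τ : ℝ} (hτ : 0 < τ) (hp : p ≤ 0) {x : ℝ} (hx : 0 ≤ x) :
    Hf p τ x ≤ τ ^ p := by
  unfold Hf
  apply Real.rpow_le_rpow_of_nonpos hτ _ hp
  nlinarith [Real.pi_gt_three]

lemma taylor_case1 {H H1 H2 H3 : ℝ → ℝ} {K a b c : ℝ} (hK : 0 ≤ K)
    (d0 : ∀ x, 1 / 4 ≤ x → HasDerivAt H (H1 x) x)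
    (d1 : ∀ x, 1 / 4 ≤ x → HasDerivAt H1 (H2 x) x)
    (d2 : ∀ x, 1 / 4 ≤ x → HasDerivAt H2 (H3 x) x)
    (b2 : ∀ x, 1 / 4 ≤ x → |H2 x| ≤ K) (b3 : ∀ x, 1 / 4 ≤ x → |H3 x| ≤ K)
    (ha : -1 ≤ a) (hb : -1 ≤ b) (hm : 1 / 2 ≤ 2 + a + b) (hc : |c| ≤ 1 / 4) :
    H (2 + a + b + c) - H (2 + a) - H (2 + b) + H 2
        - c * (H1 (2 + a) + H1 (2 + b) - H1 2) ≤ K * (2 * (|a| * |b|) + c ^ 2) := by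
  have hc' := abs_le.1 hc
  have T2 := mixed_diff d0 (lip_of_deriv d1 b2) ha hb hm
  have T3 := mixed_diff d1 (lip_of_deriv d2 b3) ha hb hm
  have T1 : H (2 + a + b + c) - H (2 + a + b) - c * H1 (2 + a + b) ≤ K * c ^ 2 := by
    have hx : ∀ x ∈ Set.uIcc (2 + a + b) (2 + a + b + c), 1 / 4 ≤ x ∧
        |x - (2 + a + b)| ≤ |c| := by
      intro x hx
      rw [Set.mem_uIcc] at hx
      refine ⟨by rcases hx with h | h <;> linarith, ?_⟩
      rcases hx with h | h
      · rw [abs_of_nonneg (by linarith)]; exact le_trans (by linarith) (le_abs_self c)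
      · rw [abs_of_nonpos (by linarith)]; exact le_trans (by linarith) (neg_le_abs c)
    have h := Convex.norm_image_sub_le_of_norm_hasDerivWithin_le (𝕜 := ℝ)
      (f := fun x => H x - H1 (2 + a + b) * x) (f' := fun x => H1 x - H1 (2 + a + b) * 1)
      (C := K * |c|)
      (s := Set.uIcc (2 + a + b) (2 + a + b + c)) (x := 2 + a + b) (y := 2 + a + b + c)
      (fun x hxx => by
        obtain ⟨h1, h2⟩ := hx x hxx
        exact ((d0 x h1).sub ((hasDerivAt_id x).const_mul _)).hasDerivWithinAt)
      (fun x hxx => by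
        obtain ⟨h1, h2⟩ := hx x hxx
        rw [mul_one, Real.norm_eq_abs]
        refine (lip_of_deriv d1 b2 x (2 + a + b) h1 (by linarith)).trans ?_
        gcongr)
      (convex_uIcc _ _) Set.left_mem_uIcc Set.right_mem_uIcc
    simp only [Real.norm_eq_abs] at h
    have h' := (le_abs_self _).trans h
    have e1 : (2 + a + b + c - (2 + a + b)) = c := by ring
    have e2 : K * |c| * |c| = K * c ^ 2 := by rw [mul_assoc, abs_mul_abs_self]; ring
    rw [e1, e2] at h'
    linarith
  have T2' := (le_abs_self _).trans T2
  have T3' : c * (H1 (2 + a + b) - H1 (2 + a) - H1 (2 + b) + H1 2) ≤ K * (|a| * |b|) := by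
    refine (le_abs_self _).trans ?_
    rw [abs_mul]
    calc _ ≤ (1 : ℝ) * (K * (|a| * |b|)) :=
          mul_le_mul (by linarith) T3 (abs_nonneg _) (by norm_num)
      _ = _ := one_mul _
  linarith

lemma taylor_case2 {K t a b c h h1 A B C D : ℝ} (hK : 1 ≤ K) (ht : 1 ≤ t)
    (h0 : h ≤ t) (h2 : h1 ≤ 1) (hA : 0 ≤ A) (hB : 0 ≤ B)
    (hC : |C| ≤ 3 * K) (hD : D = h - A - B + h1 - c * C)
    (hl : 2 + 3 * |c| ≤ 44 * (|a| * |b| + c ^ 2)) :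
    D ≤ 44 * (K * t) * (|a| * |b| + c ^ 2) := by
  have hlin : - (c * C) ≤ |c| * (3 * K) := by
    refine (neg_le_abs _).trans ?_
    rw [abs_mul]
    gcongr
  have k1 : t ≤ K * t := le_mul_of_one_le_left (by linarith) hK
  have k2 : K ≤ K * t := le_mul_of_one_le_right (by linarith) ht
  have k3 : |c| * (3 * K) ≤ |c| * (3 * (K * t)) := by gcongr
  have k4 : (K * t) * (2 + 3 * |c|) ≤ (K * t) * (44 * (|a| * |b| + c ^ 2)) :=
    mul_le_mul_of_nonneg_left hl (by linarith)
  linarith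

lemma Hf_pointwise {k : ℕ} (hk : 0 < k) {τ : ℝ} (hτ : 0 < τ) (hτ1 : τ ≤ 1) {a b c : ℝ}
    (ha : -1 ≤ a) (hb : -1 ≤ b) (habc : 0 ≤ 2 + a + b + c) :
    Hf (-(k : ℝ) / 2) τ (2 + a + b + c) - Hf (-(k : ℝ) / 2) τ (2 + a)
      - Hf (-(k : ℝ) / 2) τ (2 + b) + Hf (-(k : ℝ) / 2) τ 2
      - c * (2 * π * (-(k : ℝ) / 2)) * (Hf (-(k : ℝ) / 2 - 1) τ (2 + a)
        + Hf (-(k : ℝ) / 2 - 1) τ (2 + b) - Hf (-(k : ℝ) / 2 - 1) τ 2) ≤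
      22000 * k ^ 3 * τ ^ (-(k : ℝ) / 2) * (|a| * |b| + c ^ 2) := by
  have hk1 : (1 : ℝ) ≤ k := by exact_mod_cast hk
  set p : ℝ := -(k : ℝ) / 2 with hp
  have hp0 : p ≤ 0 := by rw [hp]; linarith
  set H := Hf p τ with hH
  set H1 : ℝ → ℝ := fun x => 2 * π * p * Hf (p - 1) τ x with hH1
  set H2 : ℝ → ℝ := fun x => 2 * π * p * (2 * π * (p - 1) * Hf (p - 1 - 1) τ x) with hH2
  set H3 : ℝ → ℝ := fun x => 2 * π * p * (2 * π * (p - 1) *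
    (2 * π * (p - 1 - 1) * Hf (p - 1 - 1 - 1) τ x)) with hH3
  set K : ℝ := 500 * k ^ 3 with hK
  have hkk : (k : ℝ) ≤ k ^ 3 := by nlinarith [mul_self_nonneg ((k : ℝ) - 1), sq_nonneg (k : ℝ)]
  have hkk2 : (k : ℝ) ^ 2 ≤ k ^ 3 := by nlinarith [sq_nonneg (k : ℝ)]
  have hK1 : 500 ≤ K := by rw [hK]; linarith
  have d0 : ∀ x, 1 / 4 ≤ x → HasDerivAt H (H1 x) x := fun x hx => Hf_deriv hτ (by linarith)
  have d1 : ∀ x, 1 / 4 ≤ x → HasDerivAt H1 (H2 x) x := fun x hx =>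
    (Hf_deriv hτ (by linarith)).const_mul _
  have d2 : ∀ x, 1 / 4 ≤ x → HasDerivAt H2 (H3 x) x := fun x hx =>
    ((Hf_deriv hτ (by linarith)).const_mul _).const_mul _
  have a0 : |2 * π * p| ≤ 3.2 * k := by
    rw [abs_le, hp]; constructor <;> nlinarith [Real.pi_pos, Real.pi_lt_d2]
  have a1 : |2 * π * (p - 1)| ≤ 9.6 * k := by
    rw [abs_le, hp]; constructor <;> nlinarith [Real.pi_pos, Real.pi_lt_d2]
  have a2 : |2 * π * (p - 1 - 1)| ≤ 16 * k := by
    rw [abs_le, hp]; constructor <;> nlinarith [Real.pi_pos, Real.pi_lt_d2]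
  have babs : ∀ q x, q ≤ 0 → 1 / 4 ≤ x → |Hf q τ x| ≤ 1 := fun q x hq hx => by
    rw [abs_of_nonneg (Hf_nonneg hτ (by linarith))]; exact Hf_le_one hτ hq hx
  have b1 : ∀ x, 1 / 4 ≤ x → |H1 x| ≤ K := by
    intro x hx
    calc |H1 x| = |2 * π * p| * |Hf (p - 1) τ x| := abs_mul _ _
      _ ≤ (3.2 * k) * 1 := mul_le_mul a0 (babs _ _ (by linarith) hx) (abs_nonneg _) (by positivity)
      _ ≤ K := by rw [hK]; linarith
  have b2 : ∀ x, 1 / 4 ≤ x → |H2 x| ≤ K := by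
    intro x hx
    calc |H2 x| = |2 * π * p| * (|2 * π * (p - 1)| * |Hf (p - 1 - 1) τ x|) := by
          rw [hH2, ← abs_mul, ← abs_mul]
      _ ≤ (3.2 * k) * ((9.6 * k) * 1) := by
          have := babs (p - 1 - 1) x (by linarith) hx
          gcongr
      _ ≤ K := by rw [hK]; linarith
  have b3 : ∀ x, 1 / 4 ≤ x → |H3 x| ≤ K := by
    intro x hx
    calc |H3 x| = |2 * π * p| * (|2 * π * (p - 1)| * (|2 * π * (p - 1 - 1)| *
            |Hf (p - 1 - 1 - 1) τ x|)) := by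
          rw [hH3, ← abs_mul, ← abs_mul, ← abs_mul]
      _ ≤ (3.2 * k) * ((9.6 * k) * ((16 * k) * 1)) := by
          have := babs (p - 1 - 1 - 1) x (by linarith) hx
          gcongr
      _ ≤ K := by rw [hK]; ring_nf; nlinarith
  have hτp : 1 ≤ τ ^ p := Real.one_le_rpow_of_pos_of_le_one_of_nonpos hτ hτ1 hp0
  have goal_eq : Hf p τ (2 + a + b + c) - Hf p τ (2 + a) - Hf p τ (2 + b) + Hf p τ 2
      - c * (2 * π * p) * (Hf (p - 1) τ (2 + a) + Hf (p - 1) τ (2 + b) - Hf (p - 1) τ 2)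
      = H (2 + a + b + c) - H (2 + a) - H (2 + b) + H 2
        - c * (H1 (2 + a) + H1 (2 + b) - H1 2) := by
    simp only [hH1, hH]; ring
  rw [goal_eq]
  have eK : 22000 * (k : ℝ) ^ 3 * τ ^ p * (|a| * |b| + c ^ 2) =
      44 * (K * τ ^ p) * (|a| * |b| + c ^ 2) := by rw [hK]; ring
  rw [eK]
  have hKτ : K ≤ K * τ ^ p := le_mul_of_one_le_right (by linarith) hτp
  by_cases hcase : 1 / 2 ≤ 2 + a + b ∧ |c| ≤ 1 / 4
  · obtain ⟨hm, hc⟩ := hcase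
    have hsum := taylor_case1 (by linarith) d0 d1 d2 b2 b3 ha hb hm hc
    refine hsum.trans ?_
    have hKt : 0 ≤ K * τ ^ p := by linarith
    have hab0 : 0 ≤ |a| * |b| := by positivity
    have hc2 : 0 ≤ c ^ 2 := sq_nonneg c
    calc K * (2 * (|a| * |b|) + c ^ 2) ≤ (K * τ ^ p) * (2 * (|a| * |b|) + c ^ 2) := by gcongr
      _ ≤ (K * τ ^ p) * (44 * (|a| * |b| + c ^ 2)) :=
          mul_le_mul_of_nonneg_left (by linarith) hKt
      _ = _ := by ring
  · have h0 : H (2 + a + b + c) ≤ τ ^ p := Hf_le hτ hp0 habc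
    have h2 : H 2 ≤ 1 := Hf_le_one hτ hp0 (by norm_num)
    have ha' : 0 ≤ H (2 + a) := Hf_nonneg hτ (by linarith)
    have hb' : 0 ≤ H (2 + b) := Hf_nonneg hτ (by linarith)
    refine taylor_case2 (by linarith) hτp h0 h2 ha' hb'
      (C := H1 (2 + a) + H1 (2 + b) - H1 2) ?_ rfl ?_
    · have q1 := abs_le.1 (b1 (2 + a) (by linarith))
      have q2 := abs_le.1 (b1 (2 + b) (by linarith))
      have q3 := abs_le.1 (b1 2 (by norm_num))
      rw [abs_le]; constructor <;> linarith
    · clear_value H1 H2 H3 H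
      clear b1 b2 b3 d0 d1 d2 h0 h2 ha' hb' goal_eq
      rw [← sq_abs c]
      by_cases hc : |c| ≤ 1 / 4
      · have hm : 2 + a + b < 1 / 2 := by
          by_contra h; exact hcase ⟨not_lt.1 h, hc⟩
        have : 1 / 4 ≤ |a| * |b| := by
          rw [abs_of_neg (by linarith : a < 0), abs_of_neg (by linarith : b < 0)]
          have u1 : 0 ≤ 1 + a := by linarith
          have u2 : 0 ≤ 1 + b := by linarith
          have := mul_nonneg u1 u2
          linarith
        have : 0 ≤ |c| ^ 2 := sq_nonneg _
        linarith
      · push Not at hc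
        have : 0 ≤ |a| * |b| := by positivity
        have : 0 ≤ |c| * (|c| - 1/4) := mul_nonneg (abs_nonneg c) (by linarith)
        have : 44 * (|a| * |b| + |c|^2) - 2 - 3 * |c| = 44 * (|a| * |b|) + 44 * (|c| * (|c| - 1/4)) + 8 * (|c| - 1/4) := by ring
        linarith

lemma fubini_sq {Ξ Ω E : Type*} [MeasurableSpace Ξ] [MeasurableSpace Ω] [MeasurableSpace E]
    (Q : Measure Ξ) (P : Measure Ω) (v : Measure E) [IsProbabilityMeasure Q]
    [IsProbabilityMeasure P] [SFinite v] (psi : Ξ → Ω → E → ℝ)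
    (hm : Measurable (fun q : (Ξ × Ω) × E => psi q.1.1 q.1.2 q.2)) {M : ℝ} (hM0 : 0 ≤ M)
    (hM : ∀ ξ ω y, |psi ξ ω y| ≤ M) (hi : ∀ ξ ω, Integrable (psi ξ ω) v)
    (h2 : ∀ ξ ω, ∫ y, |psi ξ ω y| ∂v ≤ 2) :
    Integrable (fun q : Ξ × E => (∫ ω, psi q.1 ω q.2 ∂P) ^ 2) (Q.prod v) ∧
    ∫ q : Ξ × E, (∫ ω, psi q.1 ω q.2 ∂P) ^ 2 ∂(Q.prod v) =
      ∫ w : Ω × Ω, ∫ ξ, ∫ y, psi ξ w.1 y * psi ξ w.2 y ∂v ∂Q ∂(P.prod P) := by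
  set F : (Ξ × (Ω × Ω)) × E → ℝ := fun q => psi q.1.1 q.1.2.1 q.2 * psi q.1.1 q.1.2.2 q.2 with hF
  have hFm : Measurable F := by
    refine Measurable.mul ?_ ?_
    · exact hm.comp (f := fun q : (Ξ × (Ω × Ω)) × E => ((q.1.1, q.1.2.1), q.2)) (by fun_prop)
    · exact hm.comp (f := fun q : (Ξ × (Ω × Ω)) × E => ((q.1.1, q.1.2.2), q.2)) (by fun_prop)
  have hFb : ∀ x y, |F (x, y)| ≤ |psi x.1 x.2.1 y| * M := by
    intro x y
    simp only [hF, abs_mul]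
    gcongr
    exact hM _ _ _
  have hFi : ∀ x, Integrable (fun y => F (x, y)) v := by
    intro x
    refine Integrable.mono' ((hi x.1 x.2.1).abs.mul_const M) (hFm.comp (by fun_prop : Measurable (fun y => (x, y)))).aestronglyMeasurable ?_
    exact Filter.Eventually.of_forall fun y => hFb x y
  have hInt : Integrable F ((Q.prod (P.prod P)).prod v) := by
    rw [integrable_prod_iff hFm.aestronglyMeasurable]
    refine ⟨Filter.Eventually.of_forall hFi, ?_⟩
    refine Integrable.mono' (integrable_const (2 * M)) ?_ ?_
    · exact (hFm.norm.stronglyMeasurable.integral_prod_right' (ν := v)).aestronglyMeasurable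
    · refine Filter.Eventually.of_forall fun x => ?_
      rw [Real.norm_eq_abs, abs_of_nonneg (integral_nonneg fun _ => norm_nonneg _)]
      have h3 : ∫ y, ‖F (x, y)‖ ∂v ≤ ∫ y, |psi x.1 x.2.1 y| * M ∂v :=
        integral_mono (hFi x).norm ((hi x.1 x.2.1).abs.mul_const M) fun y => hFb x y
      rw [integral_mul_const] at h3
      exact h3.trans (by gcongr; exact h2 _ _)
  set e : (Ξ × E) × (Ω × Ω) → (Ξ × (Ω × Ω)) × E := fun q => ((q.1.1, q.2), q.1.2) with he
  have hmp : MeasurePreserving e ((Q.prod v).prod (P.prod P)) ((Q.prod (P.prod P)).prod v) := by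
    have m1 := measurePreserving_prodAssoc Q v (P.prod P)
    have m2 : MeasurePreserving (Prod.map id Prod.swap) (Q.prod (v.prod (P.prod P)))
      (Q.prod ((P.prod P).prod v)) := (MeasurePreserving.id Q).prod Measure.measurePreserving_swap
    have m3 := (measurePreserving_prodAssoc Q (P.prod P) v).symm
    exact m3.comp (m2.comp m1)
  have hG : Integrable (fun q : (Ξ × E) × (Ω × Ω) => psi q.1.1 q.2.1 q.1.2 * psi q.1.1 q.2.2 q.1.2)
      ((Q.prod v).prod (P.prod P)) := hmp.integrable_comp_of_integrable hInt
  have hsq : ∀ q : Ξ × E, (∫ ω, psi q.1 ω q.2 ∂P) ^ 2 =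
      ∫ w : Ω × Ω, psi q.1 w.1 q.2 * psi q.1 w.2 q.2 ∂(P.prod P) := by
    intro q
    rw [integral_prod_mul (fun ω => psi q.1 ω q.2) (fun ω => psi q.1 ω q.2), sq]
  simp only [hsq]
  refine ⟨hG.integral_prod_left, ?_⟩
  rw [integral_integral_swap hG]
  refine integral_congr_ae ?_
  filter_upwards [hG.prod_left_ae] with w hw
  rw [integral_prod _ hw]

/-- the rescaled projection -/
def Tm {d k : ℕ} (ξ : Stiefel d k × EuclideanSpace ℝ (Fin d)) (y : EuclideanSpace ℝ (Fin d)) :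
    EuclideanSpace ℝ (Fin k) := (‖ξ.2‖ / √d) • stiefelProj ξ.1 y

lemma Tm_sub {d k : ℕ} (ξ : Stiefel d k × EuclideanSpace ℝ (Fin d))
    (x y : EuclideanSpace ℝ (Fin d)) : Tm ξ (x - y) = Tm ξ x - Tm ξ y := by
  unfold Tm; rw [stiefelProj_sub, smul_sub]

lemma measurable_Tm (d k : ℕ) : Measurable (fun q : (Stiefel d k × EuclideanSpace ℝ (Fin d)) ×
    EuclideanSpace ℝ (Fin d) => Tm q.1 q.2) := by
  unfold Tm
  refine Measurable.smul (f := fun q : (Stiefel d k × EuclideanSpace ℝ (Fin d)) ×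
    EuclideanSpace ℝ (Fin d) => ‖q.1.2‖ / √d) (by fun_prop) ?_
  exact (measurable_stiefelProj d k).comp (f := fun q : (Stiefel d k × EuclideanSpace ℝ (Fin d)) ×
    EuclideanSpace ℝ (Fin d) => (q.1.1, q.2)) (by fun_prop)

/-- centred smoothed kernel -/
def psi {d k : ℕ} (τ : ℝ) {Ω : Type} (Y : Ω → EuclideanSpace ℝ (Fin d))
    (ξ : Stiefel d k × EuclideanSpace ℝ (Fin d)) (ω : Ω) (y : EuclideanSpace ℝ (Fin k)) : ℝ :=
  gd k τ (y - Tm ξ (Y ω)) - gd k (1 + τ) y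

lemma gd_shift_integrable {k : ℕ} {s : ℝ} (hs : 0 < s) (a : EuclideanSpace ℝ (Fin k)) :
    Integrable (fun y => gd k s (y - a)) := (gd_integrable hs).comp_sub_right a

lemma gd_mul_integrable {k : ℕ} {s t : ℝ} (hs : 0 < s) (ht : 0 < t)
    (a b : EuclideanSpace ℝ (Fin k)) :
    Integrable (fun y => gd k s (y - a) * gd k t (y - b)) := by
  refine Integrable.mul_bdd (c := (2 * π * t) ^ (-(k : ℝ) / 2)) (gd_shift_integrable hs a) ?_ ?_
  · exact ((gd_continuous k t).comp (by fun_prop)).aestronglyMeasurable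
  · refine Filter.Eventually.of_forall fun y => ?_
    rw [Real.norm_eq_abs, abs_of_nonneg (gd_nonneg ht _)]
    exact gd_le ht _

lemma psi_inner {k : ℕ} {τ : ℝ} (hτ : 0 < τ) (a b : EuclideanSpace ℝ (Fin k)) :
    ∫ y, (gd k τ (y - a) - gd k (1 + τ) y) * (gd k τ (y - b) - gd k (1 + τ) y) =
      gd k (2 * τ) (a - b) - gd k (1 + 2 * τ) a - gd k (1 + 2 * τ) b + gd k (2 + 2 * τ) 0 := by
  have h1 : 0 < 1 + τ := by linarith
  have e : ∀ y, (gd k τ (y - a) - gd k (1 + τ) y) * (gd k τ (y - b) - gd k (1 + τ) y) =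
      gd k τ (y - a) * gd k τ (y - b) - gd k τ (y - a) * gd k (1 + τ) (y - 0)
       - gd k τ (y - b) * gd k (1 + τ) (y - 0) + gd k (1 + τ) (y - 0) * gd k (1 + τ) (y - 0) := by
    intro y; rw [sub_zero]; ring
  simp only [e]
  rw [integral_add, integral_sub, integral_sub, gd_conv hτ hτ, gd_conv hτ h1, gd_conv hτ h1,
    gd_conv h1 h1, sub_zero, sub_zero, sub_zero]
  · have e1 : τ + τ = 2 * τ := by ring
    have e2 : τ + (1 + τ) = 1 + 2 * τ := by ring
    have e3 : 1 + τ + (1 + τ) = 2 + 2 * τ := by ring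
    rw [e1, e2, e3]
  · exact gd_mul_integrable hτ hτ a b
  · exact gd_mul_integrable hτ h1 a 0
  · exact (gd_mul_integrable hτ hτ a b).sub (gd_mul_integrable hτ h1 a 0)
  · exact gd_mul_integrable hτ h1 b 0
  · exact ((gd_mul_integrable hτ hτ a b).sub (gd_mul_integrable hτ h1 a 0)).sub
      (gd_mul_integrable hτ h1 b 0)
  · exact gd_mul_integrable h1 h1 0 0

lemma measurable_Tm_left {d k : ℕ} (w : EuclideanSpace ℝ (Fin d)) :
    Measurable (fun ξ : Stiefel d k × EuclideanSpace ℝ (Fin d) => Tm ξ w) :=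
  (measurable_Tm d k).comp (f := fun ξ => (ξ, w)) (by fun_prop)

lemma Tm_integral {d k : ℕ} {μ : Measure (Stiefel d k)} (hμ : IsHaarStiefel μ)
    (F : EuclideanSpace ℝ (Fin k) → ℝ) (hF : Measurable F) (w : EuclideanSpace ℝ (Fin d)) :
    ∫ ξ, F (Tm ξ w) ∂(μ.prod (_root_.stdGaussian d)) =
      ∫ z, F ((‖w‖ / √d) • z) ∂(_root_.stdGaussian k) := by
  have h := proj_law hμ w
  have h1 := integral_map (μ := μ.prod (_root_.stdGaussian d)) (measurable_Tm_left (k := k) w).aemeasurable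
    (hF.aestronglyMeasurable)
  have h2 := integral_map (μ := _root_.stdGaussian k) (φ := fun z => (‖w‖ / √d) • z)
    (by fun_prop) (hF.aestronglyMeasurable)
  rw [← h1, ← h2]
  unfold Tm
  rw [h]

lemma Tm_gd_integral {d k : ℕ} {μ : Measure (Stiefel d k)} (hμ : IsHaarStiefel μ) {s : ℝ}
    (hs : 0 < s) (w : EuclideanSpace ℝ (Fin d)) :
    ∫ ξ, gd k s (Tm ξ w) ∂(μ.prod (_root_.stdGaussian d)) =
      (2 * π * (s + ‖w‖ ^ 2 / d)) ^ (-(k : ℝ) / 2) := by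
  rw [Tm_integral hμ _ (gd_continuous k s).measurable, stdG_integral, gd_scaled_int hs, div_pow,
    Real.sq_sqrt (by positivity)]

lemma Tm_gd_integrable {d k : ℕ} {μ : Measure (Stiefel d k)} (hμ : IsHaarStiefel μ) {s : ℝ}
    (hs : 0 < s) (w : EuclideanSpace ℝ (Fin d)) :
    Integrable (fun ξ => gd k s (Tm ξ w)) (μ.prod (_root_.stdGaussian d)) := by
  have := hμ.1
  refine Integrable.mono' (integrable_const ((2 * π * s) ^ (-(k : ℝ) / 2))) ?_ ?_
  · exact ((gd_continuous k s).measurable.comp (measurable_Tm_left w)).aestronglyMeasurable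
  · refine Filter.Eventually.of_forall fun y => ?_
    rw [Real.norm_eq_abs, abs_of_nonneg (gd_nonneg hs _)]
    exact gd_le hs _

lemma psi_double {d k : ℕ} {μ : Measure (Stiefel d k)} (hμ : IsHaarStiefel μ) {τ : ℝ}
    (hτ : 0 < τ) {Ω : Type} (Y : Ω → EuclideanSpace ℝ (Fin d)) (ω ω' : Ω) :
    ∫ ξ, (∫ y, psi (k := k) τ Y ξ ω y * psi τ Y ξ ω' y) ∂(μ.prod (_root_.stdGaussian d)) =
      Hf (-(k : ℝ) / 2) τ (‖Y ω - Y ω'‖ ^ 2 / d) - Hf (-(k : ℝ) / 2) τ (1 + ‖Y ω‖ ^ 2 / d)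
      - Hf (-(k : ℝ) / 2) τ (1 + ‖Y ω'‖ ^ 2 / d) + Hf (-(k : ℝ) / 2) τ 2 := by
  have := hμ.1
  unfold psi
  simp only [psi_inner hτ, ← Tm_sub]
  have i1 := Tm_gd_integrable hμ (s := 2 * τ) (by linarith) (Y ω - Y ω')
  have i2 := Tm_gd_integrable hμ (s := 1 + 2 * τ) (by linarith) (Y ω)
  have i3 := Tm_gd_integrable hμ (s := 1 + 2 * τ) (by linarith) (Y ω')
  rw [integral_add, integral_sub, integral_sub, Tm_gd_integral hμ (by linarith),
    Tm_gd_integral hμ (by linarith), Tm_gd_integral hμ (by linarith)]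
  rotate_left
  · exact i1
  · exact i2
  · exact i1.sub i2
  · exact i3
  · exact (i1.sub i2).sub i3
  · exact integrable_const _
  simp only [integral_const, probReal_univ, one_smul]
  unfold Hf gd
  simp only [norm_zero]
  have e0 : rexp (-(1 / (2 * (2 + 2 * τ))) * 0 ^ 2) = 1 := by simp
  rw [e0, mul_one]
  have e1 : ∀ t : ℝ, 1 + 2 * τ + t = 2 * τ + (1 + t) := fun t => by ring
  rw [e1, e1, add_comm 2 (2 * τ)]

lemma measurable_psi {d k : ℕ} (τ : ℝ) {Ω : Type} [MeasurableSpace Ω]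
    {Y : Ω → EuclideanSpace ℝ (Fin d)} (hY : Measurable Y) :
    Measurable (fun q : ((Stiefel d k × EuclideanSpace ℝ (Fin d)) × Ω) × EuclideanSpace ℝ (Fin k) =>
      psi τ Y q.1.1 q.1.2 q.2) := by
  unfold psi
  refine Measurable.sub ?_ ?_
  · refine (gd_continuous k τ).measurable.comp (Measurable.sub (by fun_prop) ?_)
    exact (measurable_Tm d k).comp (f := fun q : ((Stiefel d k × EuclideanSpace ℝ (Fin d)) × Ω) ×
      EuclideanSpace ℝ (Fin k) => (q.1.1, Y q.1.2)) (by fun_prop)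
  · exact (gd_continuous k _).measurable.comp (by fun_prop)

lemma psi_bdd {d k : ℕ} {τ : ℝ} (hτ : 0 < τ) {Ω : Type} (Y : Ω → EuclideanSpace ℝ (Fin d))
    (ξ : Stiefel d k × EuclideanSpace ℝ (Fin d)) (ω : Ω) (y : EuclideanSpace ℝ (Fin k)) :
    |psi τ Y ξ ω y| ≤ (2 * π * τ) ^ (-(k : ℝ) / 2) + (2 * π * (1 + τ)) ^ (-(k : ℝ) / 2) := by
  have h1 : 0 < 1 + τ := by linarith
  unfold psi
  have := gd_le hτ (y - Tm ξ (Y ω))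
  have := gd_le h1 y
  have := gd_nonneg hτ (y - Tm ξ (Y ω))
  have := gd_nonneg h1 y
  rw [abs_le]; constructor <;> linarith

lemma psi_integrable {d k : ℕ} {τ : ℝ} (hτ : 0 < τ) {Ω : Type} (Y : Ω → EuclideanSpace ℝ (Fin d))
    (ξ : Stiefel d k × EuclideanSpace ℝ (Fin d)) (ω : Ω) :
    Integrable (psi τ Y ξ ω) :=
  (gd_shift_integrable hτ _).sub (gd_integrable (by linarith))

lemma gd_shift_integral {k : ℕ} {s : ℝ} (hs : 0 < s) (a : EuclideanSpace ℝ (Fin k)) :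
    ∫ y, gd k s (y - a) = 1 := by
  rw [integral_sub_right_eq_self (fun y => gd k s y) a, gd_integral hs]

lemma psi_abs_integral {d k : ℕ} {τ : ℝ} (hτ : 0 < τ) {Ω : Type}
    (Y : Ω → EuclideanSpace ℝ (Fin d))
    (ξ : Stiefel d k × EuclideanSpace ℝ (Fin d)) (ω : Ω) :
    ∫ y, |psi τ Y ξ ω y| ≤ 2 := by
  have h1 : 0 < 1 + τ := by linarith
  have h : ∫ y, |psi τ Y ξ ω y| ≤ ∫ y, (gd k τ (y - Tm ξ (Y ω)) + gd k (1 + τ) y) := by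
    refine integral_mono (psi_integrable hτ Y ξ ω).abs
      ((gd_shift_integrable hτ _).add (gd_integrable h1)) fun y => ?_
    have := gd_nonneg hτ (y - Tm ξ (Y ω))
    have := gd_nonneg h1 y
    simp only [psi]
    rw [abs_le]; constructor <;> linarith
  rw [integral_add (gd_shift_integrable hτ _) (gd_integrable h1), gd_shift_integral hτ,
    gd_integral h1] at h
  linarith

lemma inner_prod_zero {Ω E : Type*} [MeasurableSpace Ω] [NormedAddCommGroup E]
    [InnerProductSpace ℝ E] [CompleteSpace E] {P : Measure Ω}
    [IsProbabilityMeasure P] {Y : Ω → E} (hi : Integrable Y P) (h0 : ∫ ω, Y ω ∂P = 0)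
    {φ : Ω → ℝ} (hφ : Measurable φ) {M : ℝ} (hM : ∀ ω, |φ ω| ≤ M) :
    (Integrable (fun w : Ω × Ω => φ w.1 * ⟪Y w.1, Y w.2⟫) (P.prod P) ∧
      ∫ w : Ω × Ω, φ w.1 * ⟪Y w.1, Y w.2⟫ ∂(P.prod P) = 0) ∧
    (Integrable (fun w : Ω × Ω => φ w.2 * ⟪Y w.1, Y w.2⟫) (P.prod P) ∧
      ∫ w : Ω × Ω, φ w.2 * ⟪Y w.1, Y w.2⟫ ∂(P.prod P) = 0) := by
  have hn : Integrable (fun w : Ω × Ω => ‖Y w.1‖ * ‖Y w.2‖) (P.prod P) :=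
    hi.norm.mul_prod hi.norm
  have hin : Integrable (fun w : Ω × Ω => ⟪Y w.1, Y w.2⟫) (P.prod P) := by
    refine Integrable.mono' hn ?_ (Filter.Eventually.of_forall fun w => norm_inner_le_norm _ _)
    exact (hi.1.comp_fst).inner (hi.1.comp_snd)
  have h1 : Integrable (fun w : Ω × Ω => φ w.1 * ⟪Y w.1, Y w.2⟫) (P.prod P) :=
    hin.bdd_mul (c := M) (hφ.comp measurable_fst).aestronglyMeasurable (Filter.Eventually.of_forall fun w => hM w.1)
  have e1 : ∫ w : Ω × Ω, φ w.1 * ⟪Y w.1, Y w.2⟫ ∂(P.prod P) = 0 := by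
    rw [integral_prod _ h1]
    simp only [integral_const_mul]
    have : ∀ x, ∫ y, ⟪Y x, Y y⟫ ∂P = 0 := fun x => by
      rw [integral_inner hi, h0, inner_zero_right]
    simp [this]
  refine ⟨⟨h1, e1⟩, ?_, ?_⟩
  · have := h1.swap
    refine this.congr (Filter.Eventually.of_forall fun w => ?_)
    simp [Prod.swap, real_inner_comm]
  · rw [← integral_prod_swap, ← e1]
    refine integral_congr_ae (Filter.Eventually.of_forall fun w => ?_)
    simp [Prod.swap, real_inner_comm]

lemma measurable_Hf (p τ : ℝ) : Measurable (Hf p τ) := by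
  unfold Hf; fun_prop

lemma variance_bound {d k : ℕ} (hk : 0 < k) (hd : 0 < d) {μ : Measure (Stiefel d k)}
    (hμ : IsHaarStiefel μ) {τ : ℝ} (hτ : 0 < τ) (hτ1 : τ ≤ 1) {Ω : Type} [MeasurableSpace Ω]
    (P : Measure Ω) [IsProbabilityMeasure P] {Y : Ω → EuclideanSpace ℝ (Fin d)}
    (hY : Measurable Y) (hY2 : Integrable (fun ω => ‖Y ω‖ ^ 2) P) (hY0 : ∫ ω, Y ω ∂P = 0)
    (hYd : ∫ ω, ‖Y ω‖ ^ 2 ∂P = d) {α S : ℝ} (hα : ∫ ω, |‖Y ω‖ ^ 2 / d - 1| ∂P ≤ α)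
    (hS : ∀ x, ∫ ω, ⟪Y ω, x⟫ ^ 2 ∂P ≤ S * ‖x‖ ^ 2) :
    Integrable (fun q : (Stiefel d k × EuclideanSpace ℝ (Fin d)) × EuclideanSpace ℝ (Fin k) =>
      (∫ ω, psi τ Y q.1 ω q.2 ∂P) ^ 2) ((μ.prod (_root_.stdGaussian d)).prod volume) ∧
    ∫ q : (Stiefel d k × EuclideanSpace ℝ (Fin d)) × EuclideanSpace ℝ (Fin k),
      (∫ ω, psi τ Y q.1 ω q.2 ∂P) ^ 2 ∂((μ.prod (_root_.stdGaussian d)).prod volume) ≤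
      22000 * k ^ 3 * τ ^ (-(k : ℝ) / 2) * (α ^ 2 + 4 * S / d) := by
  have := hμ.1
  have hd0 : (0 : ℝ) < d := by exact_mod_cast hd
  have hf := fubini_sq (μ.prod (_root_.stdGaussian d)) P
    (volume : Measure (EuclideanSpace ℝ (Fin k))) (psi τ Y) (measurable_psi τ hY)
    (M := (2 * π * τ) ^ (-(k : ℝ) / 2) + (2 * π * (1 + τ)) ^ (-(k : ℝ) / 2)) (by positivity)
    (psi_bdd hτ Y) (psi_integrable hτ Y) (psi_abs_integral hτ Y)
  refine ⟨hf.1, ?_⟩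
  rw [hf.2]
  simp only [psi_double hμ hτ]
  set p : ℝ := -(k : ℝ) / 2 with hp
  have hp0 : p ≤ 0 := by rw [hp]; have : (0 : ℝ) ≤ k := by positivity
                         linarith
  set K : ℝ := 22000 * k ^ 3 * τ ^ p with hK
  have hK0 : 0 ≤ K := by positivity
  have hYi : Integrable Y P := by
    have : MemLp Y 2 P := by
      rw [← integrable_norm_rpow_iff hY.aestronglyMeasurable (by norm_num) (by norm_num)]
      simpa using hY2
    exact this.integrable (by norm_num)
  set a : Ω → ℝ := fun ω => ‖Y ω‖ ^ 2 / d - 1 with ha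
  have ham : Measurable a := by simp only [ha]; fun_prop
  have ha1 : ∀ ω, -1 ≤ a ω := fun ω => by
    have : 0 ≤ ‖Y ω‖ ^ 2 / d := by positivity
    simp only [ha]; linarith
  have hai : Integrable a P := (hY2.div_const _).sub (integrable_const _)
  set φ : Ω → ℝ := fun ω => Hf (p - 1) τ (2 + a ω) with hφ
  have hφm : Measurable φ := (measurable_Hf _ _).comp (by fun_prop)
  have hφb : ∀ ω, |φ ω| ≤ 1 := fun ω => by
    simp only [hφ]
    rw [abs_of_nonneg (Hf_nonneg hτ (by linarith [ha1 ω]))]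
    exact Hf_le_one hτ (by linarith) (by linarith [ha1 ω])
  obtain ⟨⟨j1, z1⟩, ⟨j2, z2⟩⟩ := inner_prod_zero hYi hY0 hφm hφb
  obtain ⟨⟨j3, z3⟩, -⟩ := inner_prod_zero hYi hY0 (φ := fun _ => Hf (p - 1) τ 2)
    measurable_const (M := |Hf (p - 1) τ 2|) (fun _ => le_rfl)
  set D : Ω × Ω → ℝ := fun w => Hf p τ (‖Y w.1 - Y w.2‖ ^ 2 / d) - Hf p τ (1 + ‖Y w.1‖ ^ 2 / d)
      - Hf p τ (1 + ‖Y w.2‖ ^ 2 / d) + Hf p τ 2 with hD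
  have hI : Integrable (fun w : Ω × Ω => ⟪Y w.1, Y w.2⟫ ^ 2) (P.prod P) := by
    refine Integrable.mono' (hY2.mul_prod hY2) ?_ (Filter.Eventually.of_forall fun w => ?_)
    · exact (((hY.comp measurable_fst).inner (hY.comp measurable_snd)).pow_const 2).aestronglyMeasurable
    · rw [Real.norm_eq_abs, abs_of_nonneg (sq_nonneg _), ← mul_pow, ← sq_abs]
      gcongr
      exact abs_real_inner_le_norm _ _
  have hI2 : ∫ w : Ω × Ω, ⟪Y w.1, Y w.2⟫ ^ 2 ∂(P.prod P) ≤ S * d := by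
    rw [integral_prod _ hI, ← hYd, ← integral_const_mul]
    refine integral_mono hI.integral_prod_left (hY2.const_mul S) fun ω => ?_
    refine le_trans (le_of_eq ?_) (hS (Y ω))
    simp only [real_inner_comm]
  have hA : Integrable (fun w : Ω × Ω => |a w.1| * |a w.2|) (P.prod P) := hai.abs.mul_prod hai.abs
  have hA2 : ∫ w : Ω × Ω, |a w.1| * |a w.2| ∂(P.prod P) ≤ α ^ 2 := by
    rw [integral_prod_mul (fun ω => |a ω|) (fun ω => |a ω|), sq]
    have h0 : 0 ≤ ∫ ω, |a ω| ∂P := integral_nonneg fun _ => abs_nonneg _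
    exact mul_le_mul hα hα h0 (h0.trans hα)
  have key : ∀ w : Ω × Ω, D w ≤ (-(2 / d) * (2 * π * p)) * (φ w.1 * ⟪Y w.1, Y w.2⟫ +
      φ w.2 * ⟪Y w.1, Y w.2⟫ - Hf (p - 1) τ 2 * ⟪Y w.1, Y w.2⟫) +
      K * (|a w.1| * |a w.2| + 4 / d ^ 2 * ⟪Y w.1, Y w.2⟫ ^ 2) := by
    intro w
    have e : 2 + a w.1 + a w.2 + (-(2 / d) * ⟪Y w.1, Y w.2⟫) = ‖Y w.1 - Y w.2‖ ^ 2 / d := by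
      rw [norm_sub_sq_real]; simp only [ha]; field_simp; ring
    have h := Hf_pointwise hk hτ hτ1 (ha1 w.1) (ha1 w.2)
      (c := -(2 / d) * ⟪Y w.1, Y w.2⟫) (by rw [e]; positivity)
    rw [e] at h
    have e1 : 2 + a w.1 = 1 + ‖Y w.1‖ ^ 2 / d := by simp only [ha]; ring
    have e2 : 2 + a w.2 = 1 + ‖Y w.2‖ ^ 2 / d := by simp only [ha]; ring
    simp only [hD, hφ, e1, e2] at h ⊢
    have e3 : (-(2 / (d : ℝ)) * ⟪Y w.1, Y w.2⟫) ^ 2 = 4 / d ^ 2 * ⟪Y w.1, Y w.2⟫ ^ 2 := by ring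
    rw [e3, ← hp, ← hK] at h
    linarith
  have hDi : Integrable D (P.prod P) := by
    have hHi : ∀ f : Ω × Ω → ℝ, Measurable f → (∀ w, 0 ≤ f w) →
        Integrable (fun w => Hf p τ (f w)) (P.prod P) := fun f hf h0 => by
      refine Integrable.mono' (integrable_const (τ ^ p))
        ((measurable_Hf _ _).comp hf).aestronglyMeasurable (Filter.Eventually.of_forall fun w => ?_)
      rw [Real.norm_eq_abs, abs_of_nonneg (Hf_nonneg hτ (h0 w))]
      exact Hf_le hτ hp0 (h0 w)
    refine (((hHi _ ?_ ?_).sub (hHi _ ?_ ?_)).sub (hHi _ ?_ ?_)).add (integrable_const _)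
    · fun_prop
    · intro w; positivity
    · fun_prop
    · intro w; positivity
    · fun_prop
    · intro w; positivity
  have hR1 := ((j1.add j2).sub j3).const_mul (-(2 / d) * (2 * π * p))
  have hR2 := (hA.add (hI.const_mul (4 / (d : ℝ) ^ 2))).const_mul K
  have hfin := integral_mono hDi (hR1.add hR2) key
  refine hfin.trans ?_
  have s1 : ∫ w : Ω × Ω, (-(2 / d) * (2 * π * p)) * (φ w.1 * ⟪Y w.1, Y w.2⟫ +
      φ w.2 * ⟪Y w.1, Y w.2⟫ - Hf (p - 1) τ 2 * ⟪Y w.1, Y w.2⟫) ∂(P.prod P) = 0 := by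
    rw [integral_const_mul, integral_sub, integral_add j1 j2, z1, z2, z3]
    · ring
    · exact j1.add j2
    · exact j3
  have s2 : ∫ w : Ω × Ω, K * (|a w.1| * |a w.2| + 4 / d ^ 2 * ⟪Y w.1, Y w.2⟫ ^ 2) ∂(P.prod P) ≤
      K * (α ^ 2 + 4 * S / d) := by
    rw [integral_const_mul, integral_add hA (hI.const_mul _), integral_const_mul]
    gcongr
    calc 4 / (d : ℝ) ^ 2 * ∫ w : Ω × Ω, ⟪Y w.1, Y w.2⟫ ^ 2 ∂(P.prod P)
        ≤ 4 / (d : ℝ) ^ 2 * (S * d) := by gcongr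
      _ = 4 * S / d := by field_simp
  have s3 := integral_add hR1 hR2
  refine le_trans (le_of_eq s3) ?_
  refine le_trans (add_le_add (le_of_eq s1) s2) ?_
  linarith

lemma measurableSet_normgt {k : ℕ} (ρ : ℝ) :
    MeasurableSet {y : EuclideanSpace ℝ (Fin k) | ρ < ‖y‖} :=
  measurableSet_lt measurable_const measurable_norm

lemma scaled_tail {k : ℕ} {L ρ c : ℝ} (hc0 : 0 ≤ c) (hc : c ^ 2 ≤ 2) (h : 8 * (k + L) ≤ ρ ^ 2)
    (hρ : 0 ≤ ρ) :
    ∫ z, Set.indicator {y : EuclideanSpace ℝ (Fin k) | ρ < ‖y‖} (fun _ => (1 : ℝ)) (c • z)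
      ∂(_root_.stdGaussian k) ≤ rexp (-L) := by
  have h2 : (0 : ℝ) < √2 := by positivity
  have ht := stdG_tail (k := k) (L := L) (ρ := ρ / √2) (by
    rw [div_pow, Real.sq_sqrt (by norm_num)]; linarith) (by positivity)
  refine le_trans ?_ ht
  rw [← integral_indicator_one (measurableSet_normgt _)]
  refine integral_mono_of_nonneg (Filter.Eventually.of_forall fun z =>
    Set.indicator_nonneg (fun _ _ => zero_le_one) _) ?_ (Filter.Eventually.of_forall fun z => ?_)
  · exact (integrable_const (1 : ℝ)).indicator (measurableSet_normgt _)
  · simp only [Set.indicator, Set.mem_ofPred_eq, Pi.one_apply]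
    split_ifs with h1 h3 h3
    · exact le_rfl
    · exfalso
      apply h3
      rw [norm_smul, Real.norm_eq_abs, abs_of_nonneg hc0] at h1
      rw [div_lt_iff₀ h2]
      have : c ≤ √2 := Real.le_sqrt_of_sq_le hc
      calc ρ < c * ‖z‖ := h1
        _ ≤ √2 * ‖z‖ := by gcongr
        _ = ‖z‖ * √2 := mul_comm _ _
    · exact zero_le_one
    · exact le_rfl

lemma tail_gd_le {k : ℕ} {L ρ s : ℝ} (hs0 : 0 < s) (hs : s ≤ 2) (h : 8 * (k + L) ≤ ρ ^ 2)
    (hρ : 0 ≤ ρ) :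
    ∫ y in {y : EuclideanSpace ℝ (Fin k) | ρ < ‖y‖}, gd k s y ≤ rexp (-L) := by
  have := scaled_tail (k := k) (c := √s) (Real.sqrt_nonneg _)
    (by rw [Real.sq_sqrt hs0.le]; exact hs) h hρ
  rw [← gd_scale_integral hs0] at this
  refine le_trans (le_of_eq ?_) this
  rw [← integral_indicator (measurableSet_normgt _)]
  congr 1; ext y
  by_cases hy : y ∈ {y : EuclideanSpace ℝ (Fin k) | ρ < ‖y‖} <;> simp [Set.indicator, hy]

lemma tail_shift {k : ℕ} {L R s : ℝ} (hs0 : 0 < s) (hs : s ≤ 2) (h : 8 * (k + L) ≤ (R / 2) ^ 2)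
    (hR : 0 ≤ R) (x : EuclideanSpace ℝ (Fin k)) :
    ∫ y in {y : EuclideanSpace ℝ (Fin k) | R < ‖y‖}, gd k s (y - x) ≤
      Set.indicator {y : EuclideanSpace ℝ (Fin k) | R / 2 < ‖y‖} (fun _ => (1 : ℝ)) x
        + rexp (-L) := by
  by_cases hx : R / 2 < ‖x‖
  · rw [Set.indicator_of_mem (by exact hx)]
    have : ∫ y in {y : EuclideanSpace ℝ (Fin k) | R < ‖y‖}, gd k s (y - x) ≤
        ∫ y, gd k s (y - x) := setIntegral_le_integral (gd_shift_integrable hs0 x)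
          (Filter.Eventually.of_forall fun y => gd_nonneg hs0 _)
    rw [gd_shift_integral hs0] at this
    have := Real.exp_pos (-L)
    linarith
  · rw [Set.indicator_of_notMem (by exact hx), zero_add]
    refine le_trans ?_ (tail_gd_le hs0 hs h (by positivity))
    rw [← integral_indicator (measurableSet_normgt _), ← integral_indicator (measurableSet_normgt _),
      ← integral_sub_right_eq_self (Set.indicator {y : EuclideanSpace ℝ (Fin k) | R / 2 < ‖y‖}
        (fun y => gd k s y)) x]
    refine integral_mono ((gd_shift_integrable hs0 x).indicator (measurableSet_normgt _))
      (((gd_integrable hs0).indicator (measurableSet_normgt _)).comp_sub_right x) fun y => ?_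
    have hn : 0 ≤ gd k s (y - x) := gd_nonneg hs0 _
    simp only [Set.indicator, Set.mem_ofPred_eq]
    split_ifs with h1 h2 h2
    · exact le_rfl
    · exfalso
      have := norm_sub_norm_le y x
      linarith
    · exact hn
    · exact le_rfl

lemma bdd_integrable {α : Type*} [MeasurableSpace α] [TopologicalSpace α] {m : Measure α}
    [IsProbabilityMeasure m] {F : α → ℝ} (hm : AEStronglyMeasurable F m) (hb : ∀ y, |F y| ≤ 1) :
    Integrable F m :=
  Integrable.mono' (integrable_const (1 : ℝ)) hm (Filter.Eventually.of_forall hb)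

lemma scale_err {k : ℕ} {F : EuclideanSpace ℝ (Fin k) → ℝ} {σ : ℝ} (hσ : 0 ≤ σ)
    (hFc : Continuous F) (hFb : ∀ y, |F y| ≤ 1) (hFl : ∀ x y, |F x - F y| ≤ σ * ‖x - y‖)
    (x : EuclideanSpace ℝ (Fin k)) (a b : ℝ) :
    |∫ z, F (x + a • z) ∂(_root_.stdGaussian k) - ∫ z, F (x + b • z) ∂(_root_.stdGaussian k)| ≤
      σ * (|a - b| * √k) := by
  have i : ∀ a : ℝ, Integrable (fun z => F (x + a • z)) (_root_.stdGaussian k) := fun a =>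
    bdd_integrable (by fun_prop) (fun y => hFb _)
  rw [← integral_sub (i a) (i b)]
  have h1 : |∫ z, (F (x + a • z) - F (x + b • z)) ∂(_root_.stdGaussian k)| ≤
      ∫ z, σ * (|a - b| * ‖z‖) ∂(_root_.stdGaussian k) := by
    refine norm_integral_le_of_norm_le (f := fun z => F (x + a • z) - F (x + b • z)) (((stdG_norm_int k).const_mul _).const_mul _)
      (Filter.Eventually.of_forall fun z => ?_)
    refine (hFl _ _).trans (le_of_eq ?_)
    have : x + a • z - (x + b • z) = (a - b) • z := by rw [sub_smul]; abel
    rw [this, norm_smul, Real.norm_eq_abs]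
  refine h1.trans ?_
  rw [integral_const_mul, integral_const_mul]
  gcongr
  exact stdG_norm_le k

lemma smooth_err {k : ℕ} {F : EuclideanSpace ℝ (Fin k) → ℝ} {σ : ℝ} (hσ : 0 ≤ σ)
    (hFc : Continuous F) (hFb : ∀ y, |F y| ≤ 1) (hFl : ∀ x y, |F x - F y| ≤ σ * ‖x - y‖)
    {τ : ℝ} (hτ : 0 < τ) (x : EuclideanSpace ℝ (Fin k)) :
    |F x - ∫ y, F y * gd k τ (y - x)| ≤ σ * (√τ * √k) := by
  have h := scale_err hσ hFc hFb hFl x 0 (√τ)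
  have e1 : ∫ y, F y * gd k τ (y - x) = ∫ z, F (x + √τ • z) ∂(_root_.stdGaussian k) := by
    rw [← gd_scale_integral hτ (fun z => F (x + z)),
      ← integral_sub_right_eq_self (fun y => F (x + y) * gd k τ y) x]
    simp
  rw [e1]
  simpa [abs_of_nonneg (Real.sqrt_nonneg τ)] using h

lemma smooth_err' {k : ℕ} {F : EuclideanSpace ℝ (Fin k) → ℝ} {σ : ℝ} (hσ : 0 ≤ σ)
    (hFc : Continuous F) (hFb : ∀ y, |F y| ≤ 1) (hFl : ∀ x y, |F x - F y| ≤ σ * ‖x - y‖)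
    {τ : ℝ} (hτ : 0 < τ) :
    |∫ z, F z ∂(_root_.stdGaussian k) - ∫ y, F y * gd k (1 + τ) y| ≤ σ * (√τ * √k) := by
  have h := scale_err hσ hFc hFb hFl 0 1 (√(1 + τ))
  rw [gd_scale_integral (by linarith) F]
  simp only [zero_add, one_smul] at h
  refine h.trans ?_
  gcongr
  rw [abs_sub_comm, abs_of_nonneg (by
    have : 1 ≤ √(1 + τ) := Real.one_le_sqrt.2 (by linarith)
    linarith)]
  have : √(1 + τ) ≤ 1 + √τ := by
    refine Real.sqrt_le_iff.2 ⟨by positivity, ?_⟩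
    have h2 := Real.sq_sqrt hτ.le
    have h3 := Real.sqrt_nonneg τ
    linarith [add_sq 1 (√τ)]
  linarith

lemma core_err {d k : ℕ} {Ω : Type} [MeasurableSpace Ω]
    (P : Measure Ω) [IsProbabilityMeasure P] {Y : Ω → EuclideanSpace ℝ (Fin d)}
    (hY : Measurable Y) {F : EuclideanSpace ℝ (Fin k) → ℝ} {σ : ℝ} (hσ : 0 ≤ σ)
    (hFc : Continuous F) (hFb : ∀ y, |F y| ≤ 1) (hFl : ∀ x y, |F x - F y| ≤ σ * ‖x - y‖)
    {τ : ℝ} (hτ : 0 < τ) (hτ1 : τ ≤ 1) (ξ : Stiefel d k × EuclideanSpace ℝ (Fin d))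
    {R L lam : ℝ} (hR : 0 ≤ R) (hlam : 0 < lam) (h : 8 * (k + L) ≤ (R / 2) ^ 2)
    (hD : Integrable (fun y => (∫ ω, psi τ Y ξ ω y ∂P) ^ 2)) :
    |∫ ω, (∫ y, F y * psi τ Y ξ ω y) ∂P| ≤
      σ * R * (lam / 2 * (∫ y, (∫ ω, psi τ Y ξ ω y ∂P) ^ 2)
        + (volume.real (Metric.closedBall (0 : EuclideanSpace ℝ (Fin k)) R)) / (2 * lam)) +
      2 * (∫ ω, Set.indicator {y : EuclideanSpace ℝ (Fin k) | R / 2 < ‖y‖} (fun _ => (1 : ℝ))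
        (Tm ξ (Y ω)) ∂P + 2 * rexp (-L)) := by
  set B := Metric.closedBall (0 : EuclideanSpace ℝ (Fin k)) R with hB
  have hBm : MeasurableSet B := measurableSet_closedBall
  have hBf : IsFiniteMeasure (volume.restrict B) :=
    ⟨by rw [Measure.restrict_apply_univ]; exact measure_closedBall_lt_top⟩
  have hBc : Bᶜ = {y : EuclideanSpace ℝ (Fin k) | R < ‖y‖} := by
    ext y; simp [hB]
  have h1τ : 0 < 1 + τ := by linarith
  set G : EuclideanSpace ℝ (Fin k) → ℝ := fun y => F y - F 0 with hG
  have hGc : Continuous G := by fun_prop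
  have hG2 : ∀ y, |G y| ≤ 2 := fun y => by
    have h1 := abs_le.1 (hFb y)
    have h2 := abs_le.1 (hFb 0)
    simp only [hG]; rw [abs_le]; constructor <;> linarith
  have hGl : ∀ y, |G y| ≤ σ * ‖y‖ := fun y => by simpa using hFl y 0
  have hpi := psi_integrable (k := k) hτ Y ξ
  have hp0 : ∀ ω, ∫ y, psi τ Y ξ ω y = 0 := fun ω => by
    unfold psi
    rw [integral_sub (gd_shift_integrable hτ _) (gd_integrable h1τ), gd_shift_integral hτ,
      gd_integral h1τ, sub_self]
  have hGpi : ∀ ω, Integrable (fun y => G y * psi τ Y ξ ω y) := fun ω =>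
    (hpi ω).bdd_mul (c := 2) hGc.aestronglyMeasurable (Filter.Eventually.of_forall hG2)
  have hFpi : ∀ ω, Integrable (fun y => F y * psi τ Y ξ ω y) := fun ω =>
    (hpi ω).bdd_mul (c := 1) hFc.aestronglyMeasurable (Filter.Eventually.of_forall hFb)
  have e1 : ∀ ω, ∫ y, F y * psi τ Y ξ ω y =
      (∫ y in B, G y * psi τ Y ξ ω y) + ∫ y in Bᶜ, G y * psi τ Y ξ ω y := by
    intro ω
    rw [integral_add_compl hBm (hGpi ω)]
    simp only [hG, sub_mul]
    rw [integral_sub (hFpi ω) ((hpi ω).const_mul _), integral_const_mul, hp0, mul_zero, sub_zero]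
  have hpm : Measurable (fun q : Ω × EuclideanSpace ℝ (Fin k) => psi τ Y ξ q.1 q.2) :=
    (measurable_psi τ hY).comp (f := fun q : Ω × EuclideanSpace ℝ (Fin k) => ((ξ, q.1), q.2))
      (by fun_prop)
  have hprod : Integrable (fun q : Ω × EuclideanSpace ℝ (Fin k) => G q.2 * psi τ Y ξ q.1 q.2)
      (P.prod volume) := by
    have hm : Measurable (fun q : Ω × EuclideanSpace ℝ (Fin k) => G q.2 * psi τ Y ξ q.1 q.2) :=
      (hGc.measurable.comp measurable_snd).mul hpm
    rw [integrable_prod_iff hm.aestronglyMeasurable]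
    refine ⟨Filter.Eventually.of_forall hGpi, ?_⟩
    refine Integrable.mono' (integrable_const (4 : ℝ)) ?_ ?_
    · exact (hm.norm.stronglyMeasurable.integral_prod_right' (ν := volume)).aestronglyMeasurable
    · refine Filter.Eventually.of_forall fun ω => ?_
      rw [Real.norm_eq_abs, abs_of_nonneg (integral_nonneg fun _ => norm_nonneg _)]
      have h3 : ∫ y, ‖G y * psi τ Y ξ ω y‖ ≤ ∫ y, 2 * |psi τ Y ξ ω y| := by
        refine integral_mono (hGpi ω).norm ((hpi ω).abs.const_mul 2) fun y => ?_
        simp only [Real.norm_eq_abs, abs_mul]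
        gcongr
        exact hG2 y
      rw [integral_const_mul] at h3
      have := psi_abs_integral hτ Y ξ ω
      linarith
  have hprodS : ∀ s : Set (EuclideanSpace ℝ (Fin k)), Integrable (fun q : Ω × EuclideanSpace ℝ (Fin k) => G q.2 * psi τ Y ξ q.1 q.2)
      (P.prod (volume.restrict s)) := by
    intro s
    have := hprod.restrict (s := Set.univ ×ˢ s)
    rwa [← Measure.prod_restrict, Measure.restrict_univ] at this
  rw [integral_congr_ae (Filter.Eventually.of_forall e1)]
  rw [integral_add (hprodS B).integral_prod_left (hprodS Bᶜ).integral_prod_left]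
  refine (abs_add_le _ _).trans ?_
  refine add_le_add ?_ ?_
  · rw [integral_integral_swap (hprodS B)]
    have hb : |∫ y in B, (∫ ω, G y * psi τ Y ξ ω y ∂P)| ≤
        ∫ y in B, σ * R * (lam / 2 * (∫ ω, psi τ Y ξ ω y ∂P) ^ 2 + 1 / (2 * lam)) := by
      refine norm_integral_le_of_norm_le (f := fun y => ∫ ω, G y * psi τ Y ξ ω y ∂P) ?_ ?_
      · exact ((hD.restrict.const_mul _).add (integrable_const _)).const_mul _
      · refine ae_restrict_of_forall_mem hBm fun y hy => ?_
        rw [integral_const_mul, Real.norm_eq_abs, abs_mul]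
        have hy' : ‖y‖ ≤ R := by simpa [hB] using hy
        have g1 : |G y| ≤ σ * R := (hGl y).trans (by gcongr)
        have g2 : ∀ t : ℝ, |t| ≤ lam / 2 * t ^ 2 + 1 / (2 * lam) := fun t => by
          rw [← sq_abs]
          have : lam / 2 * |t| ^ 2 + 1 / (2 * lam) - |t| = (lam * |t| - 1) ^ 2 / (2 * lam) := by
            field_simp; ring
          have h3 : 0 ≤ (lam * |t| - 1) ^ 2 / (2 * lam) := by positivity
          linarith
        exact mul_le_mul g1 (g2 _) (abs_nonneg _) (by positivity)
    refine hb.trans ?_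
    rw [integral_const_mul, integral_add (hD.restrict.const_mul _) (integrable_const _),
      integral_const_mul, setIntegral_const, smul_eq_mul, mul_one_div]
    have : ∫ y in B, (∫ ω, psi τ Y ξ ω y ∂P) ^ 2 ≤ ∫ y, (∫ ω, psi τ Y ξ ω y ∂P) ^ 2 :=
      setIntegral_le_integral hD (Filter.Eventually.of_forall fun y => sq_nonneg _)
    have h5 := mul_le_mul_of_nonneg_left this (by positivity : 0 ≤ lam / 2)
    exact mul_le_mul_of_nonneg_left (by linarith) (by positivity)
  · have hind : Integrable (fun ω => Set.indicator {y : EuclideanSpace ℝ (Fin k) | R / 2 < ‖y‖}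
        (fun _ => (1 : ℝ)) (Tm ξ (Y ω))) P := by
      refine Integrable.mono' (integrable_const (1 : ℝ)) ?_ (Filter.Eventually.of_forall fun ω => ?_)
      · refine Measurable.aestronglyMeasurable ?_
        refine (measurable_const.indicator (measurableSet_normgt _)).comp ?_
        exact (measurable_Tm d k).comp (f := fun ω => (ξ, Y ω)) (by fun_prop)
      · simp only [Set.indicator]
        split_ifs <;> simp
    have hb : |∫ ω, (∫ y in Bᶜ, G y * psi τ Y ξ ω y) ∂P| ≤
        ∫ ω, 2 * (Set.indicator {y : EuclideanSpace ℝ (Fin k) | R / 2 < ‖y‖}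
        (fun _ => (1 : ℝ)) (Tm ξ (Y ω)) + 2 * rexp (-L)) ∂P := by
      refine norm_integral_le_of_norm_le (f := fun ω => ∫ y in Bᶜ, G y * psi τ Y ξ ω y)
        ((hind.add (integrable_const _)).const_mul _) (Filter.Eventually.of_forall fun ω => ?_)
      have i1 : Integrable (fun y => gd k τ (y - Tm ξ (Y ω))) (volume.restrict Bᶜ) :=
        (gd_shift_integrable hτ _).restrict
      have i2 : Integrable (gd k (1 + τ)) (volume.restrict Bᶜ) := (gd_integrable h1τ).restrict
      have h3 : |∫ y in Bᶜ, G y * psi τ Y ξ ω y| ≤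
          ∫ y in Bᶜ, 2 * (gd k τ (y - Tm ξ (Y ω)) + gd k (1 + τ) y) := by
        refine norm_integral_le_of_norm_le (f := fun y => G y * psi τ Y ξ ω y)
          ((i1.add i2).const_mul _) (Filter.Eventually.of_forall fun y => ?_)
        rw [Real.norm_eq_abs, abs_mul]
        refine mul_le_mul (hG2 y) ?_ (abs_nonneg _) (by norm_num)
        have := gd_nonneg hτ (y - Tm ξ (Y ω))
        have := gd_nonneg h1τ y
        simp only [psi]
        rw [abs_le]; constructor <;> linarith
      rw [Real.norm_eq_abs]
      refine h3.trans ?_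
      rw [integral_const_mul, integral_add i1 i2, hBc]
      have t1 := tail_shift hτ (by linarith) h hR (Tm ξ (Y ω))
      have t2 := tail_gd_le (k := k) (L := L) (ρ := R) h1τ (by linarith)
        (h.trans (by gcongr; linarith)) hR
      linarith
    refine hb.trans (le_of_eq ?_)
    rw [integral_const_mul, integral_add hind (integrable_const _)]
    simp

/-- the per-frame error bound -/
def Gtot {d k : ℕ} {Ω : Type} [MeasurableSpace Ω] (P : Measure Ω)
    (Y : Ω → EuclideanSpace ℝ (Fin d)) (σ τ R L lam : ℝ)
    (ξ : Stiefel d k × EuclideanSpace ℝ (Fin d)) : ℝ :=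
  √k * |‖ξ.2‖ / √d - 1| + 2 * (σ * (√τ * √k)) +
    (σ * R * (lam / 2 * (∫ y, (∫ ω, psi τ Y ξ ω y ∂P) ^ 2)
        + (volume.real (Metric.closedBall (0 : EuclideanSpace ℝ (Fin k)) R)) / (2 * lam)) +
      2 * (∫ ω, Set.indicator {y : EuclideanSpace ℝ (Fin k) | R / 2 < ‖y‖} (fun _ => (1 : ℝ))
        (Tm ξ (Y ω)) ∂P + 2 * rexp (-L)))

lemma total_err {d k : ℕ} {Ω : Type} [MeasurableSpace Ω]
    (P : Measure Ω) [IsProbabilityMeasure P] {Y : Ω → EuclideanSpace ℝ (Fin d)}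
    (hY : Measurable Y) {F : EuclideanSpace ℝ (Fin k) → ℝ} {σ : ℝ} (hσ : 0 ≤ σ)
    (hFc : Continuous F) (hFb : ∀ y, |F y| ≤ 1) (hFl : ∀ x y, |F x - F y| ≤ σ * ‖x - y‖)
    {τ : ℝ} (hτ : 0 < τ) (hτ1 : τ ≤ 1) (ξ : Stiefel d k × EuclideanSpace ℝ (Fin d))
    (hNi : Integrable (fun ω => ‖stiefelProj ξ.1 (Y ω)‖) P)
    (hN : σ * ∫ ω, ‖stiefelProj ξ.1 (Y ω)‖ ∂P ≤ √k)
    {R L lam : ℝ} (hR : 0 ≤ R) (hlam : 0 < lam) (h : 8 * (k + L) ≤ (R / 2) ^ 2)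
    (hD : Integrable (fun y => (∫ ω, psi τ Y ξ ω y ∂P) ^ 2)) :
    |∫ ω, F (stiefelProj ξ.1 (Y ω)) ∂P - ∫ z, F z ∂(_root_.stdGaussian k)| ≤
      Gtot P Y σ τ R L lam ξ := by
  have h1τ : 0 < 1 + τ := by linarith
  have hc := core_err P hY hσ hFc hFb hFl hτ hτ1 ξ hR hlam h hD
  set c := ∫ y, F y * gd k (1 + τ) y with hcdef
  set hh : Ω → ℝ := fun ω => ∫ y, F y * psi τ Y ξ ω y with hhh
  have hpi := psi_integrable (k := k) hτ Y ξ
  have m1 : Measurable (fun ω => stiefelProj ξ.1 (Y ω)) :=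
    (measurable_stiefelProj d k).comp (f := fun ω => (ξ.1, Y ω)) (by fun_prop)
  have m2 : Measurable (fun ω => Tm ξ (Y ω)) :=
    (measurable_Tm d k).comp (f := fun ω => (ξ, Y ω)) (by fun_prop)
  have i1 : Integrable (fun ω => F (stiefelProj ξ.1 (Y ω))) P :=
    Integrable.mono' (integrable_const (1 : ℝ)) (hFc.measurable.comp m1).aestronglyMeasurable
      (Filter.Eventually.of_forall fun ω => hFb _)
  have i2 : Integrable (fun ω => F (Tm ξ (Y ω))) P :=
    Integrable.mono' (integrable_const (1 : ℝ)) (hFc.measurable.comp m2).aestronglyMeasurable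
      (Filter.Eventually.of_forall fun ω => hFb _)
  have hpm : Measurable (fun q : Ω × EuclideanSpace ℝ (Fin k) => psi τ Y ξ q.1 q.2) :=
    (measurable_psi τ hY).comp (f := fun q : Ω × EuclideanSpace ℝ (Fin k) => ((ξ, q.1), q.2))
      (by fun_prop)
  have hFpi : ∀ ω, Integrable (fun y => F y * psi τ Y ξ ω y) := fun ω =>
    (hpi ω).bdd_mul (c := 1) hFc.aestronglyMeasurable (Filter.Eventually.of_forall hFb)
  have hFqi : Integrable (fun y => F y * gd k (1 + τ) y) :=
    (gd_integrable h1τ).bdd_mul (c := 1) hFc.aestronglyMeasurable (Filter.Eventually.of_forall hFb)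
  have i3 : Integrable hh P := by
    refine Integrable.mono' (integrable_const (2 : ℝ)) ?_ (Filter.Eventually.of_forall fun ω => ?_)
    · have hm : Measurable (fun q : Ω × EuclideanSpace ℝ (Fin k) => F q.2 * psi τ Y ξ q.1 q.2) :=
        (hFc.measurable.comp measurable_snd).mul hpm
      exact (hm.stronglyMeasurable.integral_prod_right' (ν := volume)).aestronglyMeasurable
    · refine le_trans ?_ (psi_abs_integral hτ Y ξ ω)
      refine norm_integral_le_of_norm_le (hpi ω).abs (Filter.Eventually.of_forall fun y => ?_)
      rw [Real.norm_eq_abs, abs_mul]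
      exact mul_le_of_le_one_left (abs_nonneg _) (hFb y)
  have e1 : ∀ ω, ∫ y, F y * gd k τ (y - Tm ξ (Y ω)) = hh ω + c := by
    intro ω
    rw [hhh, hcdef, ← integral_add (hFpi ω) hFqi]
    congr 1; ext y; simp only [psi]; ring
  have b1 : |∫ ω, (F (stiefelProj ξ.1 (Y ω)) - F (Tm ξ (Y ω))) ∂P| ≤
      √k * |‖ξ.2‖ / √d - 1| := by
    have : |∫ ω, (F (stiefelProj ξ.1 (Y ω)) - F (Tm ξ (Y ω))) ∂P| ≤
        ∫ ω, (σ * |‖ξ.2‖ / √d - 1|) * ‖stiefelProj ξ.1 (Y ω)‖ ∂P := by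
      refine norm_integral_le_of_norm_le
        (f := fun ω => F (stiefelProj ξ.1 (Y ω)) - F (Tm ξ (Y ω))) (hNi.const_mul _)
        (Filter.Eventually.of_forall fun ω => ?_)
      refine (hFl _ _).trans (le_of_eq ?_)
      have : stiefelProj ξ.1 (Y ω) - Tm ξ (Y ω) =
          (1 - ‖ξ.2‖ / √d) • stiefelProj ξ.1 (Y ω) := by
        unfold Tm; rw [sub_smul, one_smul]
      rw [this, norm_smul, Real.norm_eq_abs, abs_sub_comm]; ring
    refine this.trans ?_
    rw [integral_const_mul]
    calc _ = (σ * ∫ ω, ‖stiefelProj ξ.1 (Y ω)‖ ∂P) * |‖ξ.2‖ / √d - 1| := by ring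
      _ ≤ _ := by gcongr
  have b2 : |∫ ω, (F (Tm ξ (Y ω)) - (hh ω + c)) ∂P| ≤ σ * (√τ * √k) := by
    have := norm_integral_le_of_norm_le_const (μ := P)
      (f := fun ω => F (Tm ξ (Y ω)) - (hh ω + c)) (C := σ * (√τ * √k))
      (Filter.Eventually.of_forall fun ω => by
        rw [← e1 ω]; exact smooth_err hσ hFc hFb hFl hτ _)
    simpa using this
  have b3 := smooth_err' hσ hFc hFb hFl hτ
  rw [← hcdef] at b3
  have e2 : ∫ ω, (F (stiefelProj ξ.1 (Y ω)) - F (Tm ξ (Y ω))) ∂P =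
    ∫ ω, F (stiefelProj ξ.1 (Y ω)) ∂P - ∫ ω, F (Tm ξ (Y ω)) ∂P := integral_sub i1 i2
  have e3 : ∫ ω, (F (Tm ξ (Y ω)) - (hh ω + c)) ∂P = ∫ ω, F (Tm ξ (Y ω)) ∂P -
      (∫ ω, hh ω ∂P + c) := by
    rw [integral_sub, integral_add i3 (integrable_const _)]
    · simp
    · exact i2
    · exact i3.add (integrable_const _)
  rw [e2] at b1
  rw [e3] at b2
  unfold Gtot
  rw [abs_le] at b1 b2 b3 hc ⊢
  constructor <;> linarith [b1.1, b1.2, b2.1, b2.2, b3.1, b3.2, hc.1, hc.2]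

lemma dBL_nonneg {k : ℕ} (m n : Measure (EuclideanSpace ℝ (Fin k))) : 0 ≤ dBL m n :=
  Real.iSup_nonneg fun _ => abs_nonneg _

lemma dBL_le {k : ℕ} {m n : Measure (EuclideanSpace ℝ (Fin k))} {c : ℝ}
    (h : ∀ f : EuclideanSpace ℝ (Fin k) → ℝ, (∀ x, |f x| ≤ 1) → LipschitzWith 1 f →
      |∫ x, f x ∂m - ∫ x, f x ∂n| ≤ c) : dBL m n ≤ c := by
  have : Nonempty {f : EuclideanSpace ℝ (Fin k) → ℝ // (∀ x, |f x| ≤ 1) ∧ LipschitzWith 1 f} :=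
    ⟨⟨fun _ => 0, by simp, LipschitzWith.const' 0⟩⟩
  exact ciSup_le fun f => h f.1 f.2.1 f.2.2

lemma dBL_le_two {k : ℕ} (m n : Measure (EuclideanSpace ℝ (Fin k))) [IsProbabilityMeasure m]
    [IsProbabilityMeasure n] : dBL m n ≤ 2 := by
  refine dBL_le fun f hf hl => ?_
  have h1 := norm_integral_le_of_norm_le_const (μ := m) (f := f) (C := 1)
    (Filter.Eventually.of_forall hf)
  have h2 := norm_integral_le_of_norm_le_const (μ := n) (f := f) (C := 1)
    (Filter.Eventually.of_forall hf)
  simp only [Real.norm_eq_abs, probReal_univ, mul_one] at h1 h2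
  rw [abs_le] at h1 h2 ⊢
  constructor <;> linarith [h1.1, h1.2, h2.1, h2.2]

lemma dBL_le_Gtot {d k : ℕ} {Ω : Type} [MeasurableSpace Ω]
    (P : Measure Ω) [IsProbabilityMeasure P] {X Y : Ω → EuclideanSpace ℝ (Fin d)}
    (hX : Measurable X) (hY : Measurable Y) {σ : ℝ} (hσ : 0 ≤ σ) (hXY : ∀ ω, X ω = σ • Y ω)
    {τ : ℝ} (hτ : 0 < τ) (hτ1 : τ ≤ 1) (ξ : Stiefel d k × EuclideanSpace ℝ (Fin d))
    (hNi : Integrable (fun ω => ‖stiefelProj ξ.1 (Y ω)‖) P)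
    (hN : σ * ∫ ω, ‖stiefelProj ξ.1 (Y ω)‖ ∂P ≤ √k)
    {R L lam : ℝ} (hR : 0 ≤ R) (hlam : 0 < lam) (h : 8 * (k + L) ≤ (R / 2) ^ 2)
    (hD : Integrable (fun y => (∫ ω, psi τ Y ξ ω y ∂P) ^ 2)) :
    dBL (P.map fun ω => stiefelProj ξ.1 (X ω)) ((_root_.stdGaussian k).map fun z => σ • z) ≤
      Gtot P Y σ τ R L lam ξ := by
  refine dBL_le fun f hf hl => ?_
  have m1 : Measurable (fun ω => stiefelProj ξ.1 (X ω)) :=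
    (measurable_stiefelProj d k).comp (f := fun ω => (ξ.1, X ω)) (by fun_prop)
  rw [integral_map m1.aemeasurable hl.continuous.aestronglyMeasurable,
    integral_map (by fun_prop) hl.continuous.aestronglyMeasurable]
  simp only [hXY, stiefelProj_smul]
  have := total_err P hY (F := fun y => f (σ • y)) hσ
    (hl.continuous.comp (by fun_prop)) (fun y => hf _) (fun x y => by
      have := hl.dist_le_mul (σ • x) (σ • y)
      rw [Real.dist_eq, dist_eq_norm, ← smul_sub, norm_smul, Real.norm_eq_abs,
        abs_of_nonneg hσ] at this
      simpa using this) hτ hτ1 ξ hNi hN hR hlam h hD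
  exact this

lemma tail_exp_aux {d k : ℕ} (hd : 0 < d) {μ : Measure (Stiefel d k)}
    (hμ : IsHaarStiefel μ) {Ω : Type} [MeasurableSpace Ω]
    (P : Measure Ω) [IsProbabilityMeasure P] {Y : Ω → EuclideanSpace ℝ (Fin d)}
    (hY : Measurable Y) (hY2 : Integrable (fun ω => ‖Y ω‖ ^ 2) P)
    {α : ℝ} (hα : ∫ ω, |‖Y ω‖ ^ 2 / d - 1| ∂P ≤ α) {e : ℝ} (he : 0 ≤ e)
    (I : EuclideanSpace ℝ (Fin k) → ℝ) (hIm : Measurable I) (hIn : ∀ y, ‖I y‖ ≤ 1)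
    (hI : ∀ c : ℝ, 0 ≤ c → c ^ 2 ≤ 2 → ∫ z, I (c • z) ∂(_root_.stdGaussian k) ≤ e) :
    Integrable (fun ξ => ∫ ω, I (Tm ξ (Y ω)) ∂P) (μ.prod (_root_.stdGaussian d)) ∧
    ∫ ξ, (∫ ω, I (Tm ξ (Y ω)) ∂P) ∂(μ.prod (_root_.stdGaussian d)) ≤ α + e := by
  have := hμ.1
  have hd0 : (0 : ℝ) < d := by exact_mod_cast hd
  have hm : Measurable (fun q : (Stiefel d k × EuclideanSpace ℝ (Fin d)) × Ω =>
      I (Tm q.1 (Y q.2))) :=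
    hIm.comp ((measurable_Tm d k).comp (f := fun q : (Stiefel d k × EuclideanSpace ℝ (Fin d)) × Ω
      => (q.1, Y q.2)) (by fun_prop))
  have hIntg : Integrable (fun q : (Stiefel d k × EuclideanSpace ℝ (Fin d)) × Ω =>
      I (Tm q.1 (Y q.2))) ((μ.prod (_root_.stdGaussian d)).prod P) :=
    Integrable.mono' (integrable_const (1 : ℝ)) hm.aestronglyMeasurable
      (Filter.Eventually.of_forall fun q => hIn _)
  refine ⟨hIntg.integral_prod_left, ?_⟩
  rw [integral_integral_swap (f := fun ξ ω => I (Tm ξ (Y ω))) hIntg]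
  have hab : Integrable (fun ω => |‖Y ω‖ ^ 2 / d - 1|) P :=
    ((hY2.div_const _).sub (integrable_const _)).abs
  have key : ∀ ω, ∫ ξ, I (Tm ξ (Y ω)) ∂(μ.prod (_root_.stdGaussian d)) ≤
      |‖Y ω‖ ^ 2 / d - 1| + e := by
    intro ω
    by_cases hw : ‖Y ω‖ ^ 2 / d ≤ 2
    · rw [Tm_integral hμ I hIm]
      have := hI (‖Y ω‖ / √d) (by positivity)
        (by rw [div_pow, Real.sq_sqrt hd0.le]; exact hw)
      have h2 := abs_nonneg (‖Y ω‖ ^ 2 / d - 1)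
      linarith
    · push Not at hw
      have h1 := norm_integral_le_of_norm_le_const (μ := μ.prod (_root_.stdGaussian d))
        (f := fun ξ => I (Tm ξ (Y ω))) (C := 1) (Filter.Eventually.of_forall fun ξ => hIn _)
      rw [probReal_univ, mul_one] at h1
      have h2 := le_abs_self (‖Y ω‖ ^ 2 / d - 1)
      have h3 := (le_abs_self _).trans h1
      linarith
  have h4 : ∫ ω, (∫ ξ, I (Tm ξ (Y ω)) ∂(μ.prod (_root_.stdGaussian d))) ∂P ≤
      ∫ ω, (|‖Y ω‖ ^ 2 / d - 1| + e) ∂P :=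
    integral_mono hIntg.integral_prod_right (hab.add (integrable_const _)) key
  rw [integral_add hab (integrable_const _), integral_const, probReal_univ, one_smul] at h4
  linarith

lemma tail_exp {d k : ℕ} (hd : 0 < d) {μ : Measure (Stiefel d k)}
    (hμ : IsHaarStiefel μ) {Ω : Type} [MeasurableSpace Ω]
    (P : Measure Ω) [IsProbabilityMeasure P] {Y : Ω → EuclideanSpace ℝ (Fin d)}
    (hY : Measurable Y) (hY2 : Integrable (fun ω => ‖Y ω‖ ^ 2) P)
    {α : ℝ} (hα : ∫ ω, |‖Y ω‖ ^ 2 / d - 1| ∂P ≤ α)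
    {L ρ : ℝ} (h : 8 * (k + L) ≤ ρ ^ 2) (hρ : 0 ≤ ρ) :
    Integrable (fun ξ => ∫ ω, Set.indicator {y : EuclideanSpace ℝ (Fin k) | ρ < ‖y‖}
      (fun _ => (1 : ℝ)) (Tm ξ (Y ω)) ∂P) (μ.prod (_root_.stdGaussian d)) ∧
    ∫ ξ, (∫ ω, Set.indicator {y : EuclideanSpace ℝ (Fin k) | ρ < ‖y‖}
      (fun _ => (1 : ℝ)) (Tm ξ (Y ω)) ∂P) ∂(μ.prod (_root_.stdGaussian d)) ≤
      α + rexp (-L) := by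
  refine tail_exp_aux hd hμ P hY hY2 hα (exp_pos (-L)).le _
    (measurable_const.indicator (measurableSet_normgt ρ)) (fun y => ?_)
    (fun c hc0 hc => scaled_tail hc0 hc h hρ)
  refine (norm_indicator_le_norm_self _ _).trans ?_
  simp

lemma mean_dBL_le {d k : ℕ} (hk : 0 < k) (hd : 0 < d) {μ : Measure (Stiefel d k)}
    (hμ : IsHaarStiefel μ) {τ : ℝ} (hτ : 0 < τ) (hτ1 : τ ≤ 1) {Ω : Type} [MeasurableSpace Ω]
    (P : Measure Ω) [IsProbabilityMeasure P] {X Y : Ω → EuclideanSpace ℝ (Fin d)}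
    (hX : Measurable X) (hY : Measurable Y) {σ : ℝ} (hσ : 0 ≤ σ) (hXY : ∀ ω, X ω = σ • Y ω)
    (hY2 : Integrable (fun ω => ‖Y ω‖ ^ 2) P) (hY0 : ∫ ω, Y ω ∂P = 0)
    (hYd : ∫ ω, ‖Y ω‖ ^ 2 ∂P = d) {α S : ℝ} (hα : ∫ ω, |‖Y ω‖ ^ 2 / d - 1| ∂P ≤ α)
    (hS : ∀ x, ∫ ω, ⟪Y ω, x⟫ ^ 2 ∂P ≤ S * ‖x‖ ^ 2)
    (hNi : ∀ θ : Stiefel d k, Integrable (fun ω => ‖stiefelProj θ (Y ω)‖) P)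
    (hN : ∀ θ : Stiefel d k, σ * ∫ ω, ‖stiefelProj θ (Y ω)‖ ∂P ≤ √k)
    {v : ℝ} (hv1 : Integrable (fun g : EuclideanSpace ℝ (Fin d) => |‖g‖ / √d - 1|)
      (_root_.stdGaussian d))
    (hv2 : ∫ g, |‖g‖ / √d - 1| ∂(_root_.stdGaussian d) ≤ v / √d)
    {R L lam : ℝ} (hR : 0 ≤ R) (hlam : 0 < lam) (h : 8 * (k + L) ≤ (R / 2) ^ 2) :
    ∫ θ, dBL (P.map fun ω => stiefelProj θ (X ω))
      ((_root_.stdGaussian k).map fun z => σ • z) ∂μ ≤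
    √k * (v / √d) + 2 * (σ * (√τ * √k)) +
    (σ * R * (lam / 2 * (22000 * k ^ 3 * τ ^ (-(k : ℝ) / 2) * (α ^ 2 + 4 * S / d))
        + (volume.real (Metric.closedBall (0 : EuclideanSpace ℝ (Fin k)) R)) / (2 * lam)) +
      2 * ((α + rexp (-L)) + 2 * rexp (-L))) := by
  have := hμ.1
  obtain ⟨hVi, hV⟩ := variance_bound hk hd hμ hτ hτ1 P hY hY2 hY0 hYd hα hS
  obtain ⟨hTi, hT⟩ := tail_exp hd hμ P hY hY2 hα h (by positivity)
  rw [integral_prod _ hVi] at hV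
  have hVi' := hVi.integral_prod_left
  simp only at hV hVi'
  have hVa := hVi.prod_right_ae
  set Q := μ.prod (_root_.stdGaussian d) with hQ
  have hA : Integrable (fun ξ : Stiefel d k × EuclideanSpace ℝ (Fin d) => |‖ξ.2‖ / √d - 1|) Q :=
    hv1.comp_snd μ
  have hAe : ∫ ξ, |‖ξ.2‖ / √d - 1| ∂Q ≤ v / √d := by
    have := integral_fun_snd (μ := μ) (ν := _root_.stdGaussian d)
      (fun g : EuclideanSpace ℝ (Fin d) => |‖g‖ / √d - 1|)
    rw [hQ, this]; simpa using hv2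
  have hG1 : Integrable (fun ξ : Stiefel d k × EuclideanSpace ℝ (Fin d) =>
      √k * |‖ξ.2‖ / √d - 1| + 2 * (σ * (√τ * √k))) Q :=
    (hA.const_mul _).add (integrable_const _)
  have hG2 := ((hVi'.const_mul (lam / 2)).add (integrable_const
    ((volume.real (Metric.closedBall (0 : EuclideanSpace ℝ (Fin k)) R)) / (2 * lam)))).const_mul
      (σ * R)
  have hG3 := (hTi.add (integrable_const (2 * rexp (-L)))).const_mul 2
  have hG : Integrable (Gtot P Y σ τ R L lam) Q := hG1.add (hG2.add hG3)
  have hGe : ∫ ξ, Gtot P Y σ τ R L lam ξ ∂Q = √k * (∫ ξ, |‖ξ.2‖ / √d - 1| ∂Q) +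
      2 * (σ * (√τ * √k)) +
    (σ * R * (lam / 2 * (∫ ξ, (∫ y, (∫ ω, psi τ Y ξ ω y ∂P) ^ 2) ∂Q)
        + (volume.real (Metric.closedBall (0 : EuclideanSpace ℝ (Fin k)) R)) / (2 * lam)) +
      2 * ((∫ ξ, (∫ ω, Set.indicator {y : EuclideanSpace ℝ (Fin k) | R / 2 < ‖y‖}
        (fun _ => (1 : ℝ)) (Tm ξ (Y ω)) ∂P) ∂Q) + 2 * rexp (-L))) := by
    have e1 : ∫ ξ, Gtot P Y σ τ R L lam ξ ∂Q = _ := integral_add hG1 (hG2.add hG3)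
    have e2 := integral_add hG2 hG3
    have e3 := integral_add (hA.const_mul √k) (integrable_const (2 * (σ * (√τ * √k))))
    have e4 := integral_add (hVi'.const_mul (lam / 2)) (integrable_const (μ := Q)
      ((volume.real (Metric.closedBall (0 : EuclideanSpace ℝ (Fin k)) R)) / (2 * lam)))
    have e5 := integral_add hTi (integrable_const (μ := Q) (2 * rexp (-L)))
    rw [integral_const_mul, integral_const_mul] at e2
    rw [integral_const_mul] at e3 e4
    simp only [integral_const, probReal_univ, one_smul] at e3 e4 e5
    simp only [Pi.add_apply] at e1 e2 
    rw [e1, e2, e3, e4, e5]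
  have hle : ∀ᵐ ξ ∂Q, dBL (P.map fun ω => stiefelProj ξ.1 (X ω))
      ((_root_.stdGaussian k).map fun z => σ • z) ≤ Gtot P Y σ τ R L lam ξ := by
    filter_upwards [hVa] with ξ hξ
    exact dBL_le_Gtot P hX hY hσ hXY hτ hτ1 ξ (hNi _) (hN _) hR hlam h hξ
  have hle2 := Measure.ae_ae_of_ae_prod hle
  have hGa := hG.prod_right_ae
  calc _ ≤ ∫ θ, (∫ g, Gtot P Y σ τ R L lam (θ, g) ∂(_root_.stdGaussian d)) ∂μ := by
        refine integral_mono_of_nonneg (Filter.Eventually.of_forall fun θ => dBL_nonneg _ _)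
          hG.integral_prod_left ?_
        filter_upwards [hle2, hGa] with θ h1 h2
        have := integral_mono_ae (integrable_const _) h2 h1
        simpa using this
    _ = ∫ ξ, Gtot P Y σ τ R L lam ξ ∂Q := (integral_prod _ hG).symm
    _ ≤ _ := by
      rw [hGe]
      gcongr

lemma lub_quad {d : ℕ} {Ω : Type} [MeasurableSpace Ω] {P : Measure Ω}
    {X : Ω → EuclideanSpace ℝ (Fin d)}
    (hB : IsLUB {r : ℝ | ∃ ξ : EuclideanSpace ℝ (Fin d), ‖ξ‖ = 1 ∧
          r = ∫ ω, ⟪X ω, ξ⟫ ^ 2 ∂P} 1) (x : EuclideanSpace ℝ (Fin d)) :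
    ∫ ω, ⟪X ω, x⟫ ^ 2 ∂P ≤ ‖x‖ ^ 2 := by
  by_cases hx : x = 0
  · simp [hx]
  have hx0 : ‖x‖ ≠ 0 := norm_ne_zero_iff.2 hx
  have h1 : ∫ ω, ⟪X ω, ‖x‖⁻¹ • x⟫ ^ 2 ∂P ≤ 1 :=
    hB.1 ⟨‖x‖⁻¹ • x, by rw [norm_smul, norm_inv, norm_norm, inv_mul_cancel₀ hx0], rfl⟩
  simp only [real_inner_smul_right, mul_pow, integral_const_mul] at h1
  have h2 : 0 < ‖x‖ ^ 2 := by positivity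
  rw [inv_pow, inv_mul_le_iff₀ h2, mul_one] at h1
  exact h1

lemma inner_sq_integrable {d : ℕ} {Ω : Type} [MeasurableSpace Ω] {P : Measure Ω}
    {X : Ω → EuclideanSpace ℝ (Fin d)} (hX : Measurable X)
    (hX2 : Integrable (fun ω => ‖X ω‖ ^ 2) P) (x : EuclideanSpace ℝ (Fin d)) :
    Integrable (fun ω => ⟪X ω, x⟫ ^ 2) P := by
  refine Integrable.mono' (hX2.mul_const (‖x‖ ^ 2))
    ((hX.inner measurable_const).pow_const 2).aestronglyMeasurable
    (Filter.Eventually.of_forall fun ω => ?_)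
  rw [Real.norm_eq_abs, abs_of_nonneg (sq_nonneg _), ← mul_pow, ← sq_abs ⟪X ω, x⟫]
  gcongr
  exact abs_real_inner_le_norm _ _

lemma sigma_le_one {d : ℕ} (hd : 0 < d) {Ω : Type} [MeasurableSpace Ω] {P : Measure Ω}
    {X : Ω → EuclideanSpace ℝ (Fin d)} (hX : Measurable X)
    (hX2 : Integrable (fun ω => ‖X ω‖ ^ 2) P) {σ : ℝ} (hσ : 0 < σ)
    (hXd : (∫ ω, ‖X ω‖ ^ 2 ∂P) = σ ^ 2 * d)
    (hB : ∀ x, ∫ ω, ⟪X ω, x⟫ ^ 2 ∂P ≤ ‖x‖ ^ 2) : σ ≤ 1 := by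
  have hd0 : (0 : ℝ) < d := by exact_mod_cast hd
  have h1 : ∫ ω, ‖X ω‖ ^ 2 ∂P =
      ∑ i : Fin d, ∫ ω, ⟪X ω, EuclideanSpace.single i (1 : ℝ)⟫ ^ 2 ∂P := by
    rw [← integral_finsetSum _ fun i _ => inner_sq_integrable hX hX2 _]
    congr 1; ext ω
    rw [EuclideanSpace.norm_sq_eq]
    refine Finset.sum_congr rfl fun i _ => ?_
    rw [real_inner_comm, EuclideanSpace.inner_single_left]
    simp
  have h2 : ∑ i : Fin d, ∫ ω, ⟪X ω, EuclideanSpace.single i (1 : ℝ)⟫ ^ 2 ∂P ≤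
      ∑ i : Fin d, (1 : ℝ) := by
    refine Finset.sum_le_sum fun i _ => (hB _).trans ?_
    simp
  rw [← h1, hXd] at h2
  simp only [Finset.sum_const, Finset.card_univ, Fintype.card_fin, nsmul_eq_mul, mul_one] at h2
  have h3 : σ ^ 2 ≤ 1 := by
    by_contra hh
    push Not at hh
    nlinarith
  nlinarith

lemma proj_norm_le {d k : ℕ} {Ω : Type} [MeasurableSpace Ω] (P : Measure Ω)
    [IsProbabilityMeasure P]
    {X : Ω → EuclideanSpace ℝ (Fin d)} (hX : Measurable X)
    (hX2 : Integrable (fun ω => ‖X ω‖ ^ 2) P)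
    (hB : ∀ x, ∫ ω, ⟪X ω, x⟫ ^ 2 ∂P ≤ ‖x‖ ^ 2) (θ : Stiefel d k) :
    Integrable (fun ω => ‖stiefelProj θ (X ω)‖) P ∧ ∫ ω, ‖stiefelProj θ (X ω)‖ ∂P ≤ √k := by
  have m1 : Measurable (fun ω => stiefelProj θ (X ω)) :=
    (measurable_stiefelProj d k).comp (f := fun ω => (θ, X ω)) (by fun_prop)
  have hs : ∀ ω, ‖stiefelProj θ (X ω)‖ ^ 2 = ∑ i, ⟪X ω, θ.1 i⟫ ^ 2 := by
    intro ω
    rw [EuclideanSpace.norm_sq_eq]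
    refine Finset.sum_congr rfl fun i _ => ?_
    rw [stiefelProj_apply, Real.norm_eq_abs, sq_abs, real_inner_comm]
  have hi : Integrable (fun ω => ‖stiefelProj θ (X ω)‖ ^ 2) P := by
    simp only [hs]
    exact integrable_finsetSum _ fun i _ => inner_sq_integrable hX hX2 _
  have hM : MemLp (fun ω => ‖stiefelProj θ (X ω)‖) 2 P := by
    rw [memLp_two_iff_integrable_sq m1.norm.aestronglyMeasurable]
    exact hi
  refine ⟨hM.integrable (by norm_num), ?_⟩
  have h1 := sq_int_le hM
  have h2 : ∫ ω, ‖stiefelProj θ (X ω)‖ ^ 2 ∂P ≤ k := by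
    simp only [hs]
    rw [integral_finsetSum _ fun i _ => inner_sq_integrable hX hX2 _]
    calc _ ≤ ∑ i : Fin k, (1 : ℝ) := by
          refine Finset.sum_le_sum fun i _ => (hB _).trans ?_
          rw [θ.2.1 i]; norm_num
      _ = k := by simp
  exact Real.le_sqrt_of_sq_le (h1.trans h2)

lemma setup_bound {d k : ℕ} (hk : 0 < k) (hd : 0 < d) {μ : Measure (Stiefel d k)}
    (hμ : IsHaarStiefel μ) {Ω : Type} [MeasurableSpace Ω]
    (P : Measure Ω) [IsProbabilityMeasure P] {X : Ω → EuclideanSpace ℝ (Fin d)}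
    (hX : Measurable X) {σ : ℝ} (hσ : 0 < σ)
    (hX2 : Integrable (fun ω => ‖X ω‖ ^ 2) P) (hX0 : (∫ ω, X ω ∂P) = 0)
    (hXd : (∫ ω, ‖X ω‖ ^ 2 ∂P) = σ ^ 2 * d) {C' : ℝ}
    (hA : (∫ ω, |‖X ω‖ ^ 2 * (σ ^ 2)⁻¹ - (d : ℝ)| ∂P) ≤ C' * Real.sqrt d)
    (hB : ∀ x, ∫ ω, ⟪X ω, x⟫ ^ 2 ∂P ≤ ‖x‖ ^ 2)
    {v : ℝ} (hv1 : Integrable (fun g : EuclideanSpace ℝ (Fin d) => |‖g‖ / √d - 1|)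
      (_root_.stdGaussian d))
    (hv2 : ∫ g, |‖g‖ / √d - 1| ∂(_root_.stdGaussian d) ≤ v / √d)
    {τ : ℝ} (hτ : 0 < τ) (hτ1 : τ ≤ 1)
    {R L : ℝ} (hR : 0 < R) (h : 8 * (k + L) ≤ (R / 2) ^ 2) :
    ∫ θ, dBL (P.map fun ω => stiefelProj θ (X ω))
      ((_root_.stdGaussian k).map fun z => σ • z) ∂μ ≤
    √k * (v / √d) + 2 * (√τ * √k) +
    (R * (√((2 * π * rexp 1 * R ^ 2 / k) ^ ((k : ℝ) / 2)) *
        √(22000 * k ^ 3 * τ ^ (-(k : ℝ) / 2) * ((C' ^ 2 + 4) / d))) +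
      2 * (C' / √d + 3 * rexp (-L))) := by
  have hd0 : (0 : ℝ) < d := by exact_mod_cast hd
  have hk0 : (0 : ℝ) < k := by exact_mod_cast hk
  have hσ1 := sigma_le_one hd hX hX2 hσ hXd hB
  set Y : Ω → EuclideanSpace ℝ (Fin d) := fun ω => σ⁻¹ • X ω with hYdef
  have hY : Measurable Y := hX.const_smul σ⁻¹
  have hXY : ∀ ω, X ω = σ • Y ω := fun ω => by
    rw [hYdef]; simp only; rw [smul_smul, mul_inv_cancel₀ hσ.ne', one_smul]
  have hYn : ∀ ω, ‖Y ω‖ ^ 2 = ‖X ω‖ ^ 2 * (σ ^ 2)⁻¹ := fun ω => by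
    simp only [hYdef]
    rw [norm_smul, Real.norm_eq_abs, mul_pow, sq_abs, inv_pow, mul_comm]
  have hY2 : Integrable (fun ω => ‖Y ω‖ ^ 2) P := by
    simp only [hYn]; exact hX2.mul_const _
  have hY0 : ∫ ω, Y ω ∂P = 0 := by
    simp only [hYdef]; rw [integral_smul, hX0, smul_zero]
  have hYd : ∫ ω, ‖Y ω‖ ^ 2 ∂P = d := by
    simp only [hYn]; rw [integral_mul_const, hXd]; field_simp
  have hα : ∫ ω, |‖Y ω‖ ^ 2 / d - 1| ∂P ≤ C' / √d := by
    have : ∀ ω, |‖Y ω‖ ^ 2 / d - 1| = (d : ℝ)⁻¹ * |‖X ω‖ ^ 2 * (σ ^ 2)⁻¹ - (d : ℝ)| := by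
      intro ω
      rw [hYn, ← abs_of_pos (inv_pos.2 hd0), ← abs_mul]
      congr 1; field_simp
    simp only [this]
    rw [integral_const_mul]
    calc _ ≤ (d : ℝ)⁻¹ * (C' * √d) := by gcongr
      _ = _ := by
        rw [inv_mul_eq_div, div_eq_div_iff hd0.ne' (by positivity), mul_assoc,
          Real.mul_self_sqrt hd0.le]
  have hS : ∀ x, ∫ ω, ⟪Y ω, x⟫ ^ 2 ∂P ≤ (σ ^ 2)⁻¹ * ‖x‖ ^ 2 := by
    intro x
    simp only [hYdef, real_inner_smul_left, mul_pow, integral_const_mul, inv_pow]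
    have := hB x
    gcongr
  have hN1 : ∀ (θ : Stiefel d k) ω, ‖stiefelProj θ (Y ω)‖ = σ⁻¹ * ‖stiefelProj θ (X ω)‖ := by
    intro θ ω
    simp only [hYdef]
    rw [stiefelProj_smul, norm_smul, Real.norm_eq_abs, abs_of_pos (inv_pos.2 hσ)]
  have hp := proj_norm_le (k := k) P hX hX2 hB
  set v0 : ℝ := (2 * π * rexp 1 * R ^ 2 / k) ^ ((k : ℝ) / 2) with hv0
  set W : ℝ := 22000 * k ^ 3 * τ ^ (-(k : ℝ) / 2) * ((C' ^ 2 + 4) / d) with hW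
  have hv0p : 0 < v0 := by positivity
  have hWp : 0 < W := by positivity
  have hmain := mean_dBL_le hk hd hμ hτ hτ1 P hX hY hσ.le hXY hY2 hY0 hYd hα hS
    (fun θ => by simp only [hN1]; exact (hp θ).1.const_mul _)
    (fun θ => by
      simp only [hN1]; rw [integral_const_mul, ← mul_assoc, mul_inv_cancel₀ hσ.ne', one_mul]
      exact (hp θ).2) hv1 hv2 hR.le (lam := σ * (√v0 / √W)) (by positivity) h
  refine hmain.trans ?_
  have hb := ball_vol hk hR
  have hm : 0 < √v0 / √W := by positivity
  have hVW : 22000 * k ^ 3 * τ ^ (-(k : ℝ) / 2) * ((C' / √d) ^ 2 + 4 * (σ ^ 2)⁻¹ / d) ≤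
      W * (σ ^ 2)⁻¹ := by
    rw [hW, mul_assoc (22000 * (k : ℝ) ^ 3 * τ ^ (-(k : ℝ) / 2))]
    gcongr
    rw [div_pow, Real.sq_sqrt hd0.le]
    have : C' ^ 2 / d * 1 ≤ C' ^ 2 / d * (σ ^ 2)⁻¹ := by
      gcongr
      rw [one_le_inv₀ (by positivity)]
      nlinarith
    calc _ ≤ C' ^ 2 / d * (σ ^ 2)⁻¹ + 4 * (σ ^ 2)⁻¹ / d := by linarith
      _ = _ := by ring
  have hcore : σ * R * (σ * (√v0 / √W) / 2 * (22000 * k ^ 3 * τ ^ (-(k : ℝ) / 2) *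
      ((C' / √d) ^ 2 + 4 * (σ ^ 2)⁻¹ / d)) +
      volume.real (Metric.closedBall (0 : EuclideanSpace ℝ (Fin k)) R) /
        (2 * (σ * (√v0 / √W)))) ≤ R * (√v0 * √W) := by
    calc _ ≤ σ * R * (σ * (√v0 / √W) / 2 * (W * (σ ^ 2)⁻¹) + v0 / (2 * (σ * (√v0 / √W)))) := by
          gcongr
      _ = σ * R * (σ * (√v0 / √W) / 2 * (√W ^ 2 * (σ ^ 2)⁻¹) +
          √v0 ^ 2 / (2 * (σ * (√v0 / √W)))) := by
          rw [Real.sq_sqrt hv0p.le, Real.sq_sqrt hWp.le]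
      _ = R * (√v0 * √W) := by
          have h1 : √v0 ≠ 0 := by positivity
          have h2 : √W ≠ 0 := by positivity
          field_simp
          ring
  have h2 : σ * (√τ * √k) ≤ 1 * (√τ * √k) := by gcongr
  linarith

/-- main small quantity -/
def uq (d k : ℕ) : ℝ := √(k + Real.log d) * (d : ℝ) ^ (-(1 : ℝ) / (k + 2))

lemma core_param {d k : ℕ} (hk : 0 < k) (hd : 0 < d) {C c0 q : ℝ} (hC : 0 ≤ C)
    (hc0 : c0 = 64 * π * rexp 1 * rexp 6) (hq : 0 < q) :
    √((64 * π * rexp 1 * q) ^ ((k : ℝ) / 2)) *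
      √(22000 * k ^ 3 * (c0 * q * (d : ℝ) ^ (-(2 : ℝ) / (k + 2))) ^ (-(k : ℝ) / 2) * (C / d)) ≤
    √(22000 * C) * (d : ℝ) ^ (-(1 : ℝ) / (k + 2)) := by
  have hd0 : (0 : ℝ) < d := by exact_mod_cast hd
  have hk0 : (0 : ℝ) < k := by exact_mod_cast hk
  have hc : 0 < c0 := by rw [hc0]; positivity
  rw [← Real.sqrt_mul (by positivity)]
  have e1 : (d : ℝ) ^ (-(1 : ℝ) / (k + 2)) = √((d : ℝ) ^ (-(2 : ℝ) / (k + 2))) := by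
    rw [Real.sqrt_eq_rpow, ← Real.rpow_mul hd0.le]; congr 1; ring
  rw [e1, ← Real.sqrt_mul (by positivity)]
  apply Real.sqrt_le_sqrt
  have e2 : c0 * q * (d : ℝ) ^ (-(2 : ℝ) / (k + 2)) =
      (64 * π * rexp 1 * q) * rexp 6 * (d : ℝ) ^ (-(2 : ℝ) / (k + 2)) := by rw [hc0]; ring
  have hB : 0 < 64 * π * rexp 1 * q := by positivity
  rw [e2]
  clear e2
  generalize 64 * π * rexp 1 * q = B at hB ⊢
  rw [Real.mul_rpow (x := B * rexp 6) (by positivity) (by positivity),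
    Real.mul_rpow hB.le (by positivity),
    ← Real.rpow_mul hd0.le, ← Real.exp_mul]
  have e3 : B ^ ((k : ℝ) / 2) * B ^ (-(k : ℝ) / 2) = 1 := by
    rw [← Real.rpow_add hB]; ring_nf; simp
  have e4 : (d : ℝ) ^ (-(2 : ℝ) / (k + 2) * (-(k : ℝ) / 2)) / d = (d : ℝ) ^ (-(2 : ℝ) / (k + 2)) := by
    nth_rewrite 2 [← Real.rpow_one (d : ℝ)]
    rw [← Real.rpow_sub hd0]; congr 1; field_simp; ring
  have e5 : (k : ℝ) ^ 3 * rexp (6 * (-(k : ℝ) / 2)) ≤ 1 := by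
    have h1 : (k : ℝ) ≤ rexp k := by linarith [Real.add_one_le_exp (k : ℝ)]
    calc (k : ℝ) ^ 3 * rexp (6 * (-(k : ℝ) / 2)) ≤ (rexp k) ^ 3 * rexp (6 * (-(k : ℝ) / 2)) := by
          gcongr
      _ = 1 := by rw [← Real.exp_nat_mul, ← Real.exp_add]; norm_num; ring
  calc _ = (B ^ ((k : ℝ) / 2) * B ^ (-(k : ℝ) / 2)) * ((k : ℝ) ^ 3 * rexp (6 * (-(k : ℝ) / 2))) *
        (22000 * C) * ((d : ℝ) ^ (-(2 : ℝ) / (k + 2) * (-(k : ℝ) / 2)) / d) := by ring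
    _ ≤ 1 * 1 * (22000 * C) * (d : ℝ) ^ (-(2 : ℝ) / (k + 2)) := by
      rw [e3, e4]; gcongr
    _ = _ := by ring

lemma u_lower {d k : ℕ} (hk : 0 < k) (hd : 0 < d) :
    √k / √d ≤ uq d k ∧ 1 / √d ≤ uq d k ∧ rexp (-Real.log d) ≤ uq d k := by
  have hd0 : (0 : ℝ) < d := by exact_mod_cast hd
  have hd1 : (1 : ℝ) ≤ d := by exact_mod_cast hd
  have hk1 : (1 : ℝ) ≤ k := by exact_mod_cast hk
  have hL : 0 ≤ Real.log d := Real.log_nonneg hd1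
  have h1 : 1 / √d ≤ (d : ℝ) ^ (-(1 : ℝ) / (k + 2)) := by
    rw [Real.sqrt_eq_rpow, one_div, ← Real.rpow_neg hd0.le]
    apply Real.rpow_le_rpow_of_exponent_le hd1
    rw [neg_div, neg_le_neg_iff]
    apply one_div_le_one_div_of_le <;> linarith
  have h2 : √k / √d ≤ uq d k := by
    unfold uq
    rw [div_eq_mul_one_div]
    gcongr
    linarith
  have h3 : 1 / √d ≤ √k / √d := by
    gcongr
    rw [Real.one_le_sqrt]; exact hk1
  refine ⟨h2, h3.trans h2, ?_⟩
  refine le_trans ?_ (h3.trans h2)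
  rw [Real.exp_neg, Real.exp_log hd0, ← one_div]
  apply one_div_le_one_div_of_le (by positivity)
  rw [Real.sqrt_le_left hd0.le]
  nlinarith

lemma mean_le_two {d k : ℕ} {μ : Measure (Stiefel d k)}
    (hμ : IsHaarStiefel μ) {Ω : Type} [MeasurableSpace Ω]
    (P : Measure Ω) [IsProbabilityMeasure P] {X : Ω → EuclideanSpace ℝ (Fin d)}
    (hX : Measurable X) (σ : ℝ) :
    ∫ θ, dBL (P.map fun ω => stiefelProj θ (X ω))
      ((_root_.stdGaussian k).map fun z => σ • z) ∂μ ≤ 2 := by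
  have := hμ.1
  have h : ∫ θ, dBL (P.map fun ω => stiefelProj θ (X ω))
      ((_root_.stdGaussian k).map fun z => σ • z) ∂μ ≤ ∫ θ : Stiefel d k, (2 : ℝ) ∂μ := by
    refine integral_mono_of_nonneg (Filter.Eventually.of_forall fun θ => dBL_nonneg _ _)
      (integrable_const _) (Filter.Eventually.of_forall fun θ => ?_)
    have m1 : Measurable (fun ω => stiefelProj θ (X ω)) :=
      (measurable_stiefelProj d k).comp (f := fun ω => (θ, X ω)) (by fun_prop)
    have m2 : Measurable (fun z : EuclideanSpace ℝ (Fin k) => σ • z) := by fun_prop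
    have := Measure.isProbabilityMeasure_map (μ := P) m1.aemeasurable
    have := Measure.isProbabilityMeasure_map (μ := _root_.stdGaussian k) m2.aemeasurable
    exact dBL_le_two _ _
  simpa using h

lemma mean_le_u {C' v : ℝ} (hC' : 0 < C') (hv : 0 < v)
    (hvv : ∀ d : ℕ, 0 < d →
    Integrable (fun g : EuclideanSpace ℝ (Fin d) => |‖g‖ / √d - 1|) (_root_.stdGaussian d) ∧
    ∫ g, |‖g‖ / √d - 1| ∂(_root_.stdGaussian d) ≤ v / √d) {d k : ℕ} (hk : 0 < k) (hd : 0 < d)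
    {μ : Measure (Stiefel d k)}
    (hμ : IsHaarStiefel μ) {Ω : Type} [MeasurableSpace Ω]
    (P : Measure Ω) [IsProbabilityMeasure P] {X : Ω → EuclideanSpace ℝ (Fin d)}
    (hX : Measurable X) {σ : ℝ} (hσ : 0 < σ)
    (hX2 : Integrable (fun ω => ‖X ω‖ ^ 2) P) (hX0 : (∫ ω, X ω ∂P) = 0)
    (hXd : (∫ ω, ‖X ω‖ ^ 2 ∂P) = σ ^ 2 * d)
    (hA : (∫ ω, |‖X ω‖ ^ 2 * (σ ^ 2)⁻¹ - (d : ℝ)| ∂P) ≤ C' * Real.sqrt d)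
    (hB : ∀ x, ∫ ω, ⟪X ω, x⟫ ^ 2 ∂P ≤ ‖x‖ ^ 2) :
    ∫ θ, dBL (P.map fun ω => stiefelProj θ (X ω))
      ((_root_.stdGaussian k).map fun z => σ • z) ∂μ ≤
    (v + 2 * √(64 * π * rexp 1 * rexp 6) + √32 * √(22000 * (C' ^ 2 + 4)) + 2 * C' + 6) *
      uq d k := by
  have hd0 : (0 : ℝ) < d := by exact_mod_cast hd
  have hd1 : (1 : ℝ) ≤ d := by exact_mod_cast hd
  have hk0 : (0 : ℝ) < k := by exact_mod_cast hk
  have hL : 0 ≤ Real.log d := Real.log_nonneg hd1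
  obtain ⟨u1, u2, u3⟩ := u_lower hk hd
  have hu0 : 0 ≤ uq d k := by unfold uq; positivity
  set L := Real.log d with hLdef
  set c0 : ℝ := 64 * π * rexp 1 * rexp 6 with hc0
  have hc : 0 < c0 := by positivity
  set q : ℝ := 1 + L / k with hq
  have hq0 : 0 < q := by positivity
  have hqk : q * k = k + L := by rw [hq]; field_simp
  set D : ℝ := (d : ℝ) ^ (-(1 : ℝ) / (k + 2)) with hD
  have hDp : 0 < D := by positivity
  have hD2 : (d : ℝ) ^ (-(2 : ℝ) / (k + 2)) = D ^ 2 := by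
    rw [hD, ← Real.rpow_natCast, ← Real.rpow_mul hd0.le]; congr 1; push_cast; ring
  set τ : ℝ := c0 * q * (d : ℝ) ^ (-(2 : ℝ) / (k + 2)) with hτdef
  have hτ : 0 < τ := by positivity
  have hu : uq d k = √(k + L) * D := rfl
  have hsτ : √τ * √k = √c0 * uq d k := by
    rw [← Real.sqrt_mul hτ.le, hτdef, hD2,
      show c0 * q * D ^ 2 * k = c0 * (q * k) * D ^ 2 by ring, hqk,
      Real.sqrt_mul (by positivity), Real.sqrt_sq hDp.le, Real.sqrt_mul hc.le, hu, mul_assoc]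
  by_cases hτ1 : τ ≤ 1
  · have hm := setup_bound hk hd hμ P hX hσ hX2 hX0 hXd hA hB (hvv d hd).1 (hvv d hd).2 hτ hτ1
      (R := √(32 * (k + L))) (L := L) (by positivity) (by
        rw [div_pow, Real.sq_sqrt (by positivity)]; linarith)
    have hcp := core_param (C := C' ^ 2 + 4) hk hd (by positivity) hc0 hq0
    have e1 : 2 * π * rexp 1 * √(32 * (k + L)) ^ 2 / k = 64 * π * rexp 1 * q := by
      rw [Real.sq_sqrt (by positivity), ← hqk]; field_simp; ring
    rw [e1] at hm
    have h1 : √(32 * (k + L)) * (√((64 * π * rexp 1 * q) ^ ((k : ℝ) / 2)) *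
        √(22000 * k ^ 3 * τ ^ (-(k : ℝ) / 2) * ((C' ^ 2 + 4) / d))) ≤
        √32 * √(22000 * (C' ^ 2 + 4)) * uq d k := by
      calc _ ≤ √(32 * (k + L)) * (√(22000 * (C' ^ 2 + 4)) * D) := by gcongr
        _ = _ := by rw [Real.sqrt_mul (by norm_num), hu]; ring
    have h2 : √k * (v / √d) ≤ v * uq d k := by
      calc _ = v * (√k / √d) := by ring
        _ ≤ _ := by gcongr
    have h3 : C' / √d ≤ C' * uq d k := by
      calc _ = C' * (1 / √d) := by ring
        _ ≤ _ := by gcongr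
    rw [hsτ] at hm
    linarith
  · push Not at hτ1
    refine (mean_le_two hμ P hX σ).trans ?_
    have h1 : 1 ≤ √τ * √k := by
      have a1 : 1 ≤ √τ := Real.one_le_sqrt.2 hτ1.le
      have a2 : 1 ≤ √(k : ℝ) := Real.one_le_sqrt.2 (by exact_mod_cast hk)
      nlinarith
    rw [hsτ] at h1
    have h2 : 0 ≤ (v + √32 * √(22000 * (C' ^ 2 + 4)) + 2 * C' + 6) * uq d k := by positivity
    linarith

lemma final_calc {d k : ℕ} (hk : 0 < k) (hd : 0 < d) {E C2 : ℝ} (hE0 : 0 ≤ E) (hE2 : E ≤ 2)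
    (hC2 : 1 ≤ C2) (hE : E ≤ C2 * uq d k) :
    E ≤ 2 * C2 * rexp 1 * ((k + Real.log d)
                / ((k : ℝ) ^ ((2 : ℝ) / 3) * (d : ℝ) ^ ((2 : ℝ) / (3 * k + 4)))) := by
  have hd0 : (0 : ℝ) < d := by exact_mod_cast hd
  have hd1 : (1 : ℝ) ≤ d := by exact_mod_cast hd
  have hk0 : (0 : ℝ) < k := by exact_mod_cast hk
  have hk1 : (1 : ℝ) ≤ k := by exact_mod_cast hk
  have hL : 0 ≤ Real.log d := Real.log_nonneg hd1
  set L := Real.log d with hLdef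
  set a : ℝ := 2 * (k + 2) / (3 * k + 4) with ha
  have ha0 : 0 < a := by positivity
  have ha1 : a ≤ 1 := by rw [ha, div_le_one (by positivity)]; linarith
  have hkL : 0 < k + L := by positivity
  have hu0 : 0 ≤ uq d k := by unfold uq; positivity
  have h1 : E ≤ 2 * C2 * (uq d k) ^ a := by
    rcases hE0.eq_or_lt with h | h
    · rw [← h]; positivity
    calc E = E ^ (1 - a) * E ^ a := by rw [← Real.rpow_add h]; simp
      _ ≤ 2 ^ (1 - a) * (C2 * uq d k) ^ a := by
        gcongr
      _ = 2 ^ (1 - a) * C2 ^ a * (uq d k) ^ a := by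
        rw [Real.mul_rpow (by positivity) hu0]; ring
      _ ≤ 2 ^ (1 : ℝ) * C2 ^ (1 : ℝ) * (uq d k) ^ a := by
        gcongr
        · norm_num
        · linarith
      _ = _ := by rw [Real.rpow_one, Real.rpow_one]
  have h2 : (uq d k) ^ a = (k + L) ^ (a / 2) * ((d : ℝ) ^ ((2 : ℝ) / (3 * k + 4)))⁻¹ := by
    unfold uq
    rw [Real.mul_rpow (by positivity) (by positivity), Real.sqrt_eq_rpow, ← Real.rpow_mul hkL.le,
      ← Real.rpow_mul hd0.le, ← Real.rpow_neg hd0.le]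
    congr 2
    · ring
    · rw [ha]; field_simp
  have h3 : (k : ℝ) ^ ((2 : ℝ) / 3) * (k + L) ^ (a / 2) ≤ rexp 1 * (k + L) := by
    have e1 : (k : ℝ) ^ ((2 : ℝ) / 3) ≤ rexp 1 * (k : ℝ) ^ (1 - a / 2) := by
      rw [Real.rpow_def_of_pos hk0, Real.rpow_def_of_pos hk0, ← Real.exp_add]
      apply Real.exp_le_exp.2
      have e2 : 1 - a / 2 = 2 / 3 - 2 / (3 * (3 * k + 4)) := by rw [ha]; field_simp; ring
      have e3 : Real.log k ≤ k := (Real.log_le_sub_one_of_pos hk0).trans (by linarith)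
      have e4 : Real.log k * (2 / (3 * (3 * k + 4))) ≤ 1 := by
        calc _ ≤ (k : ℝ) * (2 / (3 * (3 * k + 4))) := by gcongr
          _ ≤ 1 := by rw [mul_div_assoc', div_le_one (by positivity)]; linarith
      rw [e2]; linarith
    calc _ ≤ rexp 1 * (k : ℝ) ^ (1 - a / 2) * (k + L) ^ (a / 2) := by gcongr
      _ ≤ rexp 1 * (k + L) ^ (1 - a / 2) * (k + L) ^ (a / 2) := by
        gcongr
        · linarith
        · linarith
      _ = _ := by rw [mul_assoc, ← Real.rpow_add hkL]; simp
  refine h1.trans ?_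
  rw [h2, mul_assoc (2 * C2) (rexp 1)]
  refine mul_le_mul_of_nonneg_left ?_ (by positivity)
  rw [← div_div, mul_div_assoc', ← div_eq_mul_inv]
  gcongr
  rw [mul_div_assoc', le_div_iff₀ (by positivity)]
  linarith

/-- **Theorem 3 (dist-bdX), second statement.** Under the additional assumptions
`A ≤ C'√d` and `B = 1`, there is a constant `C` (depending only on `C'`) such that
`𝔼 d_BL(X_θ, σZ) ≤ C (k + log d)/(k^{2/3} d^{2/(3k+4)})`. -/
theorem projections_dist_bdX_isotropic (C' : ℝ) (hC' : 0 < C') :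
    ∃ C : ℝ, 0 < C ∧
      ∀ {Ω : Type} [MeasurableSpace Ω] (P : Measure Ω), ∀ _ : IsProbabilityMeasure P,
      ∀ (d k : ℕ), 0 < k → k ≤ d →
      ∀ (X : Ω → EuclideanSpace ℝ (Fin d)), Measurable X →
      ∀ σ : ℝ, 0 < σ →
      Integrable (fun ω => ‖X ω‖ ^ 2) P →
      (∫ ω, X ω ∂P) = 0 →
      (∫ ω, ‖X ω‖ ^ 2 ∂P) = σ ^ 2 * d →
      (∫ ω, |‖X ω‖ ^ 2 * (σ ^ 2)⁻¹ - (d : ℝ)| ∂P) ≤ C' * Real.sqrt d →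
      IsLUB {r : ℝ | ∃ ξ : EuclideanSpace ℝ (Fin d), ‖ξ‖ = 1 ∧
          r = ∫ ω, ⟪X ω, ξ⟫ ^ 2 ∂P} 1 →
      ∀ (μ : Measure (Stiefel d k)), IsHaarStiefel μ →
        (∫ θ, dBL (P.map fun ω => stiefelProj θ (X ω))
            ((stdGaussian k).map fun z => σ • z) ∂μ)
          ≤ C * ((k + Real.log d)
                / ((k : ℝ) ^ ((2 : ℝ) / 3) * (d : ℝ) ^ ((2 : ℝ) / (3 * k + 4)))) := by
  obtain ⟨v, hv, hvv⟩ := norm_conc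
  refine ⟨2 * (v + 2 * √(64 * π * rexp 1 * rexp 6) + √32 * √(22000 * (C' ^ 2 + 4)) +
    2 * C' + 6) * rexp 1, by positivity, ?_⟩
  intro Ω _ P hP d k hk hkd X hX σ hσ hX2 hX0 hXd hA hB μ hμ
  have hd : 0 < d := lt_of_lt_of_le hk hkd
  refine final_calc hk hd (integral_nonneg fun θ => dBL_nonneg _ _) (mean_le_two hμ P hX σ) ?_
    (mean_le_u hC' hv hvv hk hd hμ P hX hσ hX2 hX0 hXd hA (lub_quad hB))
  have h1 : 0 ≤ v + 2 * √(64 * π * rexp 1 * rexp 6) + √32 * √(22000 * (C' ^ 2 + 4)) +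
    2 * C' := by positivity
  linarith

end
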